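/- arXiv:1305.1748 — 9 statements merged into one kernel-verified Lean document; each statement's English description precedes it below -/
import Mathlib

section
/- Let S be a Poisson algebra over a field k and let (M, ·, {-,-}_M) be a right Poisson module over S. Let Ω¹(S) be the S-module of Kähler differentials of S over k with universal derivation d, and let Ω^k(S) = Λ^k_S Ω¹(S) be its k-th exterior power over S. Suppose that for every k ≥ 1 a k-linear map ∂_k : M ⊗_S Ω^k(S) → M ⊗_S Ω^{k−1}(S) is given satisfying, for all m ∈ M and a_1, …, a_k ∈ S, ∂_k(m ⊗ da_1∧⋯∧da_k) = Σ_{1≤i≤k} (−1)^{i+1} {m, a_i}_M ⊗ da_1∧⋯∧(omit da_i)∧⋯∧da_k + Σ_{1≤i<j≤k} (−1)^{i+j} m ⊗ d{a_i, a_j}∧da_1∧⋯∧(omit da_i)∧⋯∧(omit da_j)∧⋯∧da_k. Then ∂_{k−1} ∘ ∂_k = 0 for all k ≥ 2. -/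
open scoped TensorProduct

/-- `skipTwo i j` enumerates, in increasing order, the elements of `ℕ` different
from `i` and `j` (for `i < j`): it is the increasing map avoiding `i` and `j`. -/
def skipTwo (i j t : ℕ) : ℕ := if t < i then t else if t + 1 < j then t + 1 else t + 2

section

variable (k : Type*) [Field k] (S : Type*) [CommRing S] [Algebra k S]

/-- `da_1 ∧ ⋯ ∧ da_n` as an element of the `n`-th exterior power `⋀[S]^n Ω¹(S)`. -/
noncomputable def wedgeOfForms (n : ℕ) (v : Fin n → Ω[S⁄k]) : ⋀[S]^n (Ω[S⁄k]) :=
  ⟨ExteriorAlgebra.ιMulti S n v, ExteriorAlgebra.ιMulti_range S n (Set.mem_range_self v)⟩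

end

theorem skipTwo_lt (i j : ℕ) {t n : ℕ} (h : t + 2 < n) : skipTwo i j t < n := by
  unfold skipTwo
  split_ifs <;> omega

theorem skipTwo_pred_lt (i j : ℕ) {l n : ℕ} (h0 : l ≠ 0) (hl : l < n) :
    skipTwo i j (l - 1) < n + 1 :=
  skipTwo_lt i j (by omega)

/-- A homotopy argument: if the operators `L a` of degree `0` are the graded commutators of the
differential `bd` with the operators `e a` of degree `1`, if the `L a` represent the bracket
(up to sign) and act on the `e b` by derivations, and if the elements `e a x` generate
everything in positive degree, then `bd` squares to zero. -/
theorem bd_bd_eq_zero_of_homotopy {A : Type*} [AddCommGroup A] (br : A → A → A)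
    (hjac : ∀ a b c, br b (br a c) - br a (br b c) = -br (br a b) c)
    (X : ℕ → Type*) [∀ n, AddCommGroup (X n)]
    (bd : ∀ n, X (n + 1) →+ X n) (e : ∀ n, A →+ X n →+ X (n + 1)) (L : ∀ n, A → X n →+ X n)
    (h_zero : ∀ a x, bd 0 (e 0 a x) = L 0 a x)
    (h_succ : ∀ n a x, bd (n + 1) (e (n + 1) a x) = L (n + 1) a x - e n a (bd n x))
    (h_der : ∀ n a b x, L (n + 1) a (e n b x) = e n b (L n a x) - e n (br a b) x)
    (h_lie : ∀ a b x, L 0 b (L 0 a x) - L 0 a (L 0 b x) = L 0 (br a b) x)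
    (h_ext : ∀ n m (f g : X (n + 1) →+ X m), (∀ a x, f (e n a x) = g (e n a x)) → f = g)
    (n : ℕ) : (bd n).comp (bd (n + 1)) = 0 := by
  have lie : ∀ n a b x, L n b (L n a x) - L n a (L n b x) = L n (br a b) x := by
    intro n
    induction n with
    | zero => exact h_lie
    | succ n ih =>
      intro a b
      refine DFunLike.congr_fun (h_ext n (n + 1)
        ((L (n + 1) b).comp (L (n + 1) a) - (L (n + 1) a).comp (L (n + 1) b))
        (L (n + 1) (br a b)) fun c x => ?_)
      have hj := congrArg (fun s => e n s x) (hjac a b c)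
      have hl := congrArg (e n c) (ih a b x)
      simp only [map_sub, map_neg, AddMonoidHom.sub_apply, AddMonoidHom.neg_apply] at hj hl
      simp only [AddMonoidHom.sub_apply, AddMonoidHom.comp_apply, h_der, map_sub]
      rw [← hl, sub_eq_add_neg _ ((e n (br (br a b) c)) x), ← hj]
      abel
  have comm : ∀ n a x, bd n (L (n + 1) a x) = L n a (bd n x) := by
    intro n
    induction n with
    | zero =>
      intro a
      refine DFunLike.congr_fun (h_ext 0 0 ((bd 0).comp (L 1 a)) ((L 0 a).comp (bd 0))
        fun b x => ?_)
      have hl := lie 0 a b x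
      simp only [AddMonoidHom.comp_apply, h_der, map_sub, h_zero]
      rw [← hl]
      abel
    | succ n ih =>
      intro a
      refine DFunLike.congr_fun (h_ext (n + 1) (n + 1)
        ((bd (n + 1)).comp (L (n + 2) a)) ((L (n + 1) a).comp (bd (n + 1))) fun b x => ?_)
      have hl := lie (n + 1) a b x
      simp only [AddMonoidHom.comp_apply, h_der, map_sub, h_succ, ih]
      rw [← hl]
      abel
  induction n with
  | zero =>
    refine h_ext 1 0 _ _ fun a x => ?_
    simp [h_succ, h_zero, comm]
  | succ n ih =>
    refine h_ext (n + 2) (n + 1) _ _ fun a x => ?_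
    have h : bd n (bd (n + 1) x) = 0 := DFunLike.congr_fun ih x
    simp [h_succ, comm, h]

section

variable (k : Type*) [Field k] (S : Type*) [CommRing S] [Algebra k S]

/-- The exact form `dw_0 ∧ ⋯ ∧ dw_{n-1}`. -/
noncomputable def exactForm (n : ℕ) (w : Fin n → S) : ⋀[S]^n (Ω[S⁄k]) :=
  wedgeOfForms k S n fun i => KaehlerDifferential.D k S (w i)

theorem wedgeOfForms_eq_ιMulti (n : ℕ) (v : Fin n → Ω[S⁄k]) :
    wedgeOfForms k S n v = exteriorPower.ιMulti S n v := rfl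

theorem span_range_exactForm (n : ℕ) : Submodule.span S (Set.range (exactForm k S n)) = ⊤ := by
  rw [← exteriorPower.ιMulti_span_of_span S n _ (KaehlerDifferential.span_range_derivation k S)]
  congr 1
  ext x
  constructor
  · rintro ⟨w, rfl⟩
    exact ⟨fun i => KaehlerDifferential.D k S (w i),
      Set.range_subset_iff.2 fun i => ⟨w i, rfl⟩, rfl⟩
  · rintro ⟨v, hv, rfl⟩
    choose w hw using fun i => hv ⟨i, rfl⟩
    exact ⟨w, by simp only [exactForm, hw]; rfl⟩

/-- Left exterior multiplication by a `1`-form. -/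
noncomputable def wedgeLeft (n : ℕ) :
    Ω[S⁄k] →ₗ[S] ⋀[S]^n (Ω[S⁄k]) →ₗ[S] ⋀[S]^(n + 1) (Ω[S⁄k]) :=
  exteriorPower.alternatingMapLinearEquiv.toLinearMap ∘ₗ
    (exteriorPower.ιMulti S (n + 1)).curryLeft

theorem wedgeLeft_wedgeOfForms (n : ℕ) (x : Ω[S⁄k]) (v : Fin n → Ω[S⁄k]) :
    wedgeLeft k S n x (wedgeOfForms k S n v) = wedgeOfForms k S (n + 1) (Fin.cons x v) := by
  rw [wedgeOfForms_eq_ιMulti, wedgeOfForms_eq_ιMulti]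
  simp only [wedgeLeft, LinearMap.comp_apply, LinearEquiv.coe_coe,
    exteriorPower.alternatingMapLinearEquiv_apply_ιMulti]
  rfl

theorem wedgeLeft_exactForm (n : ℕ) (a : S) (w : Fin n → S) :
    wedgeLeft k S n (KaehlerDifferential.D k S a) (exactForm k S n w)
      = exactForm k S (n + 1) (Fin.cons a w) := by
  rw [exactForm, wedgeLeft_wedgeOfForms, exactForm]
  congr 1
  ext i
  cases i using Fin.cases <;> simp

theorem exactForm_cons_cons (n : ℕ) (a b : S) (w : Fin n → S) :
    exactForm k S (n + 2) (Fin.cons a (Fin.cons b w))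
      = -exactForm k S (n + 2) (Fin.cons b (Fin.cons a w)) := by
  rw [exactForm, exactForm, wedgeOfForms_eq_ιMulti, wedgeOfForms_eq_ιMulti,
    ← AlternatingMap.map_swap _ _ (show (0 : Fin (n + 2)) ≠ 1 by simp)]
  congr 1
  ext i
  refine Fin.cases ?_ (fun i => Fin.cases ?_ (fun i => ?_) i) i
  · simp
  · simp
  · rw [Function.comp_apply, Equiv.swap_apply_of_ne_of_ne] <;> simp [Fin.ext_iff]

theorem exactForm_cons_succAbove (n : ℕ) (x : S) (w : Fin (n + 1) → S) (j : Fin (n + 1)) :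
    exactForm k S (n + 1) (Fin.cons x fun l => w (j.succAbove l))
      = (-1 : ℤ) ^ (j : ℕ) • exactForm k S (n + 1) (Function.update w j x) := by
  have h := AlternatingMap.neg_one_pow_smul_map_insertNth
    (exteriorPower.ιMulti S (n + 1)) j (KaehlerDifferential.D k S x)
    (fun l => KaehlerDifferential.D k S (w (j.succAbove l)))
  rw [exactForm, exactForm, wedgeOfForms_eq_ιMulti, wedgeOfForms_eq_ιMulti]
  have h₁ : (fun i => KaehlerDifferential.D k S
      ((Fin.cons x fun l => w (j.succAbove l) : Fin (n + 1) → S) i)) =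
      Matrix.vecCons (KaehlerDifferential.D k S x)
        (fun l => KaehlerDifferential.D k S (w (j.succAbove l))) := by
    ext i
    cases i using Fin.cases <;> simp
  have h₂ : (fun i => KaehlerDifferential.D k S (Function.update w j x i)) =
      j.insertNth (KaehlerDifferential.D k S x)
        (fun l => KaehlerDifferential.D k S (w (j.succAbove l))) := by
    ext i
    cases i using j.succAboveCases <;> simp
  rw [h₁, h₂, ← h]

variable {S}
variable (M : Type*) [AddCommGroup M] [Module S M]

theorem addMonoidHom_ext_exactForm {n : ℕ} {Y : Type*} [AddCommGroup Y]
    {f g : M ⊗[S] (⋀[S]^n (Ω[S⁄k])) →+ Y}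
    (h : ∀ m w, f (m ⊗ₜ exactForm k S n w) = g (m ⊗ₜ exactForm k S n w)) : f = g := by
  ext x
  induction x with
  | zero => simp
  | add x y hx hy => simp [hx, hy]
  | tmul m ω =>
    have hω : ω ∈ Submodule.span S (Set.range (exactForm k S n)) := by
      rw [span_range_exactForm]; trivial
    induction hω using Submodule.span_induction generalizing m with
    | mem x hx => obtain ⟨w, rfl⟩ := hx; exact h m w
    | zero => simp
    | add x y _ _ hx hy => simp [TensorProduct.tmul_add, hx, hy]
    | smul s x _ hx => rw [← TensorProduct.smul_tmul, hx]

/-- The operator `m ⊗ ω ↦ m ⊗ (da ∧ ω)`. -/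
noncomputable def tensorWedge (n : ℕ) :
    S →+ M ⊗[S] (⋀[S]^n (Ω[S⁄k])) →+ M ⊗[S] (⋀[S]^(n + 1) (Ω[S⁄k])) where
  toFun a := (LinearMap.lTensor M (wedgeLeft k S n (KaehlerDifferential.D k S a))).toAddMonoidHom
  map_zero' := by ext; simp
  map_add' a b := by ext; simp [LinearMap.lTensor_add]

theorem tensorWedge_exactForm (n : ℕ) (a : S) (m : M) (w : Fin n → S) :
    tensorWedge k M n a (m ⊗ₜ exactForm k S n w)
      = m ⊗ₜ exactForm k S (n + 1) (Fin.cons a w) := by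
  rw [← wedgeLeft_exactForm]
  rfl

theorem addMonoidHom_ext_tensorWedge {n : ℕ} {Y : Type*} [AddCommGroup Y]
    {f g : M ⊗[S] (⋀[S]^(n + 1) (Ω[S⁄k])) →+ Y}
    (h : ∀ a x, f (tensorWedge k M n a x) = g (tensorWedge k M n a x)) : f = g := by
  refine addMonoidHom_ext_exactForm k M fun m w => ?_
  rw [← Fin.cons_self_tail w, ← tensorWedge_exactForm]
  exact h _ _

variable {M}

/-- The Poisson boundary of `m ⊗ dw_0 ∧ ⋯ ∧ dw_n`. -/
noncomputable def boundaryFormula (br : S → S → S) (pb : M → S → M) (n : ℕ) (m : M)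
    (w : Fin (n + 1) → S) : M ⊗[S] (⋀[S]^n (Ω[S⁄k])) :=
  (∑ i : Fin (n + 1), (-1 : ℤ) ^ (i : ℕ) •
      (pb m (w i) ⊗ₜ[S] exactForm k S n fun l => w (i.succAbove l)))
    + ∑ i : Fin (n + 1), ∑ j : Fin (n + 1),
        if i < j then
          (-1 : ℤ) ^ ((i : ℕ) + (j : ℕ)) •
            (m ⊗ₜ[S] exactForm k S n fun l =>
              if h0 : (l : ℕ) = 0 then br (w i) (w j)
              else w ⟨skipTwo i.val j.val (l.val - 1),
            skipTwo_pred_lt _ _ h0 l.isLt⟩)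
        else 0

/-- The Cartan-type formula for the boundary of `m ⊗ da ∧ dw_0 ∧ ⋯ ∧ dw_n`. -/
theorem boundaryFormula_cons (br : S → S → S) (pb : M → S → M) (n : ℕ) (m : M) (a : S)
    (w : Fin (n + 1) → S) :
    boundaryFormula k br pb (n + 1) m (Fin.cons a w)
        + tensorWedge k M n a (boundaryFormula k br pb n m w)
      = pb m a ⊗ₜ exactForm k S (n + 1) w
        - ∑ j, m ⊗ₜ exactForm k S (n + 1) (Function.update w j (br a (w j))) := by
  have h_first : ∀ i : Fin (n + 1),
      (fun l => (Fin.cons a w : Fin (n + 2) → S) (i.succ.succAbove l))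
        = Fin.cons a fun l => w (i.succAbove l) := by
    intro i
    ext l
    cases l using Fin.cases <;> simp
  have h_head : ∀ j : Fin (n + 1),
      (fun l : Fin (n + 1) => if h0 : (l : ℕ) = 0 then br a (w j)
        else (Fin.cons a w : Fin (n + 2) → S) ⟨skipTwo 0 (j.succ : Fin (n + 2)) (l.val - 1),
            skipTwo_pred_lt _ _ h0 l.isLt⟩)
        = Fin.cons (br a (w j)) fun l => w (j.succAbove l) := by
    intro j
    ext l
    cases l using Fin.cases with
    | zero => simp
    | succ l =>
      simp only [Fin.val_succ, Nat.add_eq_zero_iff, one_ne_zero, and_false, dite_false,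
        Fin.cons_succ, Nat.add_sub_cancel]
      rw [← Fin.cons_succ (α := fun _ => S) a w]
      congr 1
      simp only [skipTwo, Fin.ext_iff, Fin.succAbove, Fin.lt_def, Fin.val_succ]
      split_ifs <;> (simp_all; try omega)
  have h_tail : ∀ i j : Fin (n + 1), i < j →
      exactForm k S (n + 1) (fun l : Fin (n + 1) => if h0 : (l : ℕ) = 0 then br (w i) (w j)
        else (Fin.cons a w : Fin (n + 2) → S)
          ⟨skipTwo (i.succ : Fin (n + 2)) (j.succ : Fin (n + 2)) (l.val - 1),
            skipTwo_pred_lt _ _ h0 l.isLt⟩)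
        = -exactForm k S (n + 1) (Fin.cons a fun l : Fin n =>
            if h0 : (l : ℕ) = 0 then br (w i) (w j)
            else w ⟨skipTwo i.val j.val (l.val - 1),
            skipTwo_pred_lt _ _ h0 l.isLt⟩) := by
    intro i j hij
    obtain _ | n := n
    · omega
    · have h₁ : (fun l : Fin (n + 1) => if h0 : (l : ℕ) = 0 then br (w i) (w j)
            else w ⟨skipTwo i.val j.val (l.val - 1),
            skipTwo_pred_lt _ _ h0 l.isLt⟩) =
          Fin.cons (br (w i) (w j)) fun l : Fin n => w ⟨skipTwo i.val j.val l,
            skipTwo_lt _ _ (by omega)⟩ := by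
        ext l
        cases l using Fin.cases <;> simp
      rw [h₁, ← exactForm_cons_cons]
      congr 1
      ext l
      refine Fin.cases ?_ (fun l => Fin.cases ?_ (fun l => ?_) l) l
      · simp
      · simp [skipTwo]
      · simp only [Fin.val_succ, Nat.add_eq_zero_iff, one_ne_zero, and_false, dite_false,
          Fin.cons_succ, Nat.add_sub_cancel]
        rw [← Fin.cons_succ (α := fun _ => S) a w]
        congr 1
        simp only [skipTwo, Fin.ext_iff, Fin.val_succ]
        split_ifs <;> simp_all
  have h_brackets :
      (∑ j : Fin (n + 1), (-1 : ℤ) ^ ((0 : ℕ) + (j.succ : Fin (n + 2))) •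
        (m ⊗ₜ[S] exactForm k S (n + 1) (Fin.cons (br a (w j)) fun l => w (j.succAbove l))))
        = -∑ j, m ⊗ₜ[S] exactForm k S (n + 1) (Function.update w j (br a (w j))) := by
    rw [← Finset.sum_neg_distrib]
    refine Finset.sum_congr rfl fun j _ => ?_
    rw [exactForm_cons_succAbove, ← TensorProduct.tmul_smul, smul_smul, ← pow_add,
      zero_add, Fin.val_succ, Odd.neg_one_pow ⟨j, by ring⟩, neg_one_smul, TensorProduct.tmul_neg]
  rw [sub_eq_add_neg, ← h_brackets, boundaryFormula, boundaryFormula, Fin.sum_univ_succ,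
    Fin.sum_univ_succ (f := fun i : Fin (n + 2) => ∑ j : Fin (n + 2), _)]
  simp only [Fin.sum_univ_succ (n := n + 1), Fin.cons_zero, Fin.cons_succ, h_first,
    Fin.succAbove_zero, Fin.succ_lt_succ_iff, lt_irrefl, if_false, Fin.not_lt_zero, Fin.succ_pos,
    if_true, zero_add, Fin.val_zero, pow_zero, one_smul, h_head]
  have h_action : (∑ i : Fin (n + 1), (-1 : ℤ) ^ (i.succ : ℕ) •
      (pb m (w i) ⊗ₜ[S] exactForm k S (n + 1) (Fin.cons a fun l => w (i.succAbove l))))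
        = -tensorWedge k M n a (∑ i : Fin (n + 1), (-1 : ℤ) ^ (i : ℕ) •
            (pb m (w i) ⊗ₜ[S] exactForm k S n fun l => w (i.succAbove l))) := by
    simp only [map_sum, map_zsmul, tensorWedge_exactForm, Fin.val_succ, pow_succ, mul_neg, mul_one,
      neg_smul, Finset.sum_neg_distrib]
  rw [h_action, map_add, ← sub_eq_zero]
  have h_pairs : ∀ s p t q r : M ⊗[S] (⋀[S]^(n + 1) (Ω[S⁄k])), t = -q →
      s + -p + (r + t) + (p + q) - (s + r) = 0 := by
    rintro s p t q r rfl
    abel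
  apply h_pairs
  simp only [map_sum, ← Finset.sum_neg_distrib]
  refine Finset.sum_congr rfl fun i _ => Finset.sum_congr rfl fun j _ => ?_
  split_ifs with hij
  · rw [h_tail i j hij, map_zsmul, tensorWedge_exactForm, TensorProduct.tmul_neg, smul_neg,
      Fin.val_succ, Fin.val_succ, show (i : ℕ) + 1 + (j + 1) = i + j + 2 by ring, pow_add]
    simp
  · simp

variable (bd : ∀ n, M ⊗[S] (⋀[S]^(n + 1) (Ω[S⁄k])) →+ M ⊗[S] (⋀[S]^n (Ω[S⁄k])))

/-- The graded commutator of the boundary with the exterior multiplication by `da`. -/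
noncomputable def lieOperator :
    ∀ n, S → M ⊗[S] (⋀[S]^n (Ω[S⁄k])) →+ M ⊗[S] (⋀[S]^n (Ω[S⁄k]))
  | 0, a => (bd 0).comp (tensorWedge k M 0 a)
  | n + 1, a =>
    (bd (n + 1)).comp (tensorWedge k M (n + 1) a) + (tensorWedge k M n a).comp (bd n)

variable {k bd}

theorem lieOperator_exactForm {br : S → S → S} {pb : M → S → M}
    (hbd : ∀ n m w, bd n (m ⊗ₜ exactForm k S (n + 1) w) = boundaryFormula k br pb n m w)
    (n : ℕ) (a : S) (m : M) (w : Fin n → S) :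
    lieOperator k bd n a (m ⊗ₜ exactForm k S n w)
      = pb m a ⊗ₜ exactForm k S n w
        - ∑ j, m ⊗ₜ exactForm k S n (Function.update w j (br a (w j))) := by
  cases n with
  | zero =>
    rw [lieOperator, AddMonoidHom.comp_apply, tensorWedge_exactForm, hbd, boundaryFormula]
    simp [Subsingleton.elim _ w]
  | succ n =>
    rw [lieOperator, AddMonoidHom.add_apply, AddMonoidHom.comp_apply, AddMonoidHom.comp_apply,
      tensorWedge_exactForm, hbd, hbd, boundaryFormula_cons]

theorem lieOperator_tensorWedge {br : S → S → S} {pb : M → S → M}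
    (hbd : ∀ n m w, bd n (m ⊗ₜ exactForm k S (n + 1) w) = boundaryFormula k br pb n m w)
    (n : ℕ) (a b : S) (x : M ⊗[S] (⋀[S]^n (Ω[S⁄k]))) :
    lieOperator k bd (n + 1) a (tensorWedge k M n b x)
      = tensorWedge k M n b (lieOperator k bd n a x) - tensorWedge k M n (br a b) x := by
  refine DFunLike.congr_fun (addMonoidHom_ext_exactForm k M
    (f := (lieOperator k bd (n + 1) a).comp (tensorWedge k M n b))
    (g := (tensorWedge k M n b).comp (lieOperator k bd n a) - tensorWedge k M n (br a b))
    fun m w => ?_) x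
  simp only [AddMonoidHom.comp_apply, AddMonoidHom.sub_apply, tensorWedge_exactForm,
    lieOperator_exactForm hbd, map_sub, map_sum, Fin.sum_univ_succ, Fin.cons_zero, Fin.cons_succ,
    Fin.update_cons_zero, Fin.cons_update]
  abel

theorem boundary_comp_boundary_eq_zero {br : S → S → S} {pb : M → S → M}
    (hjac : ∀ a b c, br b (br a c) - br a (br b c) = -br (br a b) c)
    (hlie : ∀ x a b, pb (pb x a) b - pb (pb x b) a = pb x (br a b))
    (hbd : ∀ n m w, bd n (m ⊗ₜ exactForm k S (n + 1) w) = boundaryFormula k br pb n m w)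
    (n : ℕ) : (bd n).comp (bd (n + 1)) = 0 := by
  refine bd_bd_eq_zero_of_homotopy br hjac (fun n => M ⊗[S] (⋀[S]^n (Ω[S⁄k]))) bd
    (tensorWedge k M) (lieOperator k bd) (fun _ _ => rfl) (fun n a x => ?_)
    (lieOperator_tensorWedge hbd) (fun a b => ?_)
    (fun _ _ _ _ h => addMonoidHom_ext_tensorWedge k M h) n
  · rw [lieOperator, AddMonoidHom.add_apply]
    exact (add_sub_cancel_right _ _).symm
  · refine DFunLike.congr_fun (addMonoidHom_ext_exactForm k M
      (f := (lieOperator k bd 0 b).comp (lieOperator k bd 0 a)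
        - (lieOperator k bd 0 a).comp (lieOperator k bd 0 b))
      (g := lieOperator k bd 0 (br a b)) fun m w => ?_)
    simp [lieOperator_exactForm hbd, ← TensorProduct.sub_tmul, hlie]

end

/-- the Poisson boundary operator on `M ⊗_S Ω^•(S)` squares to
zero.  Here `∂ n` plays the role of `∂_{n+1} : M ⊗_S Ω^{n+1}(S) → M ⊗_S Ω^n(S)`
of the paper, and the conclusion `(∂ n) ∘ (∂ (n+1)) = 0` is `∂_{k-1} ∘ ∂_k = 0`
for all `k ≥ 2`. -/
theorem poisson_boundary_squares_to_zero
    (k : Type*) [Field k] (S : Type*) [CommRing S] [Algebra k S]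
    -- the Poisson bracket on S, k-bilinear
    (br : S →ₗ[k] S →ₗ[k] S)
    (hanti : ∀ a b : S, br a b = - br b a)
    (hjacobi : ∀ a b c : S, br a (br b c) + br b (br c a) + br c (br a b) = 0)
    (hleib : ∀ a b c : S, br a (b * c) = br a b * c + br a c * b)
    -- a right Poisson module M over S (right S-modules over the commutative
    -- ring S are identified with S-modules, `x · s = s • x`)
    (M : Type*) [AddCommGroup M] [Module k M] [Module S M] [IsScalarTower k S M]
    (pb : M →ₗ[k] S →ₗ[k] M)
    (hpb_lie : ∀ (x : M) (a b : S), pb (pb x a) b - pb (pb x b) a = pb x (br a b))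
    (hpb3 : ∀ (x : M) (a b : S), pb (a • x) b = a • pb x b + br a b • x)
    (hpb4 : ∀ (x : M) (a b : S), pb x (a * b) = b • pb x a + a • pb x b)
    -- the boundary operators: `∂ n : M ⊗_S Ω^{n+1}(S) → M ⊗_S Ω^n(S)`
    (bd : ∀ n : ℕ,
      (M ⊗[S] (⋀[S]^(n+1) (Ω[S⁄k]))) →ₗ[k] (M ⊗[S] (⋀[S]^n (Ω[S⁄k]))))
    -- the defining formula of the boundary, on the spanning elements
    -- `m ⊗ da_0 ∧ ⋯ ∧ da_n`
    (hbd : ∀ (n : ℕ) (m : M) (a : Fin (n+1) → S),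
      bd n (m ⊗ₜ[S] wedgeOfForms k S (n+1) (fun i => KaehlerDifferential.D k S (a i)))
        = (∑ i : Fin (n+1), (-1 : ℤ)^(i : ℕ) •
            (pb m (a i) ⊗ₜ[S]
              wedgeOfForms k S n (fun l => KaehlerDifferential.D k S (a (i.succAbove l)))))
          + ∑ i : Fin (n+1), ∑ j : Fin (n+1),
              if i < j then
                (-1 : ℤ)^((i : ℕ) + (j : ℕ)) •
                  (m ⊗ₜ[S] wedgeOfForms k S n (fun l =>
                    if h0 : (l : ℕ) = 0 then
                      KaehlerDifferential.D k S (br (a i) (a j))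
                    else
                      KaehlerDifferential.D k S (a ⟨skipTwo i.val j.val (l.val - 1), by
                        have h1 := l.isLt
                        simp only [skipTwo]; split_ifs <;> omega⟩)))
              else 0) :
    ∀ n : ℕ, (bd n) ∘ₗ (bd (n+1)) = 0 := by
  intro n
  have h := boundary_comp_boundary_eq_zero (k := k) (bd := fun n => (bd n).toAddMonoidHom)
    (br := fun a b => br a b) (pb := fun m a => pb m a) (fun a b c => ?_) hpb_lie
    (fun n m w => ?_) n
  · ext1 x
    exact DFunLike.congr_fun h x
  · have h := hjacobi a b c
    rw [hanti c a, hanti c (br a b), map_neg] at h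
    linear_combination -h
  · refine (hbd n m w).trans ?_
    simp only [boundaryFormula, exactForm, apply_dite (KaehlerDifferential.D k S)]
end

section
/- Let S be a Poisson algebra over a field k, let k ≥ 0, and let P ∈ 𝔛^k(S). Define δ_k(P) : S^{k+1} → S by δ_k(P)(y_0, …, y_k) = Σ_{0≤i≤k} (−1)^i {y_i, P(y_0, …, (omit y_i), …, y_k)} + Σ_{0≤i<j≤k} (−1)^{i+j} P({y_i, y_j}, y_0, …, (omit y_i), …, (omit y_j), …, y_k). Then δ_k(P) ∈ 𝔛^{k+1}(S), i.e. δ_k(P) is skew-symmetric and a derivation in each argument. -/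
section PolyDer

variable (k : Type*) [Field k] (S : Type*) [CommRing S] [Algebra k S]

/-- `P : S^m → S` is `k`-multilinear. -/
def IsMultilin (m : ℕ) (P : (Fin m → S) → S) : Prop :=
  (∀ (a : Fin m → S) (i : Fin m) (x y : S),
      P (Function.update a i (x + y)) = P (Function.update a i x) + P (Function.update a i y)) ∧
  (∀ (a : Fin m → S) (i : Fin m) (c : k) (x : S),
      P (Function.update a i (c • x)) = c • P (Function.update a i x))

/-- `P : S^m → S` is skew-symmetric:
`P(a_1, …, a_m) = ε(θ) P(a_{θ(1)}, …, a_{θ(m)})` for every permutation `θ`. -/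
def IsSkewSym (m : ℕ) (P : (Fin m → S) → S) : Prop :=
  ∀ (θ : Equiv.Perm (Fin m)) (a : Fin m → S),
    P a = (Equiv.Perm.sign θ : ℤ) • P (fun i => a (θ i))

/-- `P : S^m → S` is a derivation in each argument. -/
def IsMultiDer (m : ℕ) (P : (Fin m → S) → S) : Prop :=
  ∀ (a : Fin m → S) (i : Fin m) (x y : S),
    P (Function.update a i (x * y)) =
      x * P (Function.update a i y) + y * P (Function.update a i x)

/-- membership in `𝔛^m(S)`: `k`-multilinear, skew-symmetric, and a derivation
in each argument.  (`𝔛^0(S) = S` since `(Fin 0 → S) → S ≅ S` and the three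
conditions are vacuous for `m = 0`.) -/
def IsPolyDer (m : ℕ) (P : (Fin m → S) → S) : Prop :=
  IsMultilin k S m P ∧ IsSkewSym S m P ∧ IsMultiDer S m P

/-- The Poisson coboundary `δ_m : 𝔛^m(S) → 𝔛^{m+1}(S)` (written here on all
maps `S^m → S`), for a Poisson bracket `br` on `S`:
`δ_m(P)(y_0, …, y_m) = Σ_i (−1)^i {y_i, P(y_0, …, ŷ_i, …, y_m)}
 + Σ_{i<j} (−1)^{i+j} P({y_i, y_j}, y_0, …, ŷ_i, …, ŷ_j, …, y_m)`. -/
noncomputable def pDelta (br : S →ₗ[k] S →ₗ[k] S) (m : ℕ) (P : (Fin m → S) → S) :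
    (Fin (m+1) → S) → S := fun y =>
  (∑ i : Fin (m+1), (-1 : ℤ)^(i : ℕ) • br (y i) (P (fun l => y (i.succAbove l))))
  + ∑ i : Fin (m+1), ∑ j : Fin (m+1),
      if i < j then
        (-1 : ℤ)^((i : ℕ) + (j : ℕ)) • P (fun l =>
          if h0 : (l : ℕ) = 0 then br (y i) (y j)
          else y ⟨skipTwo i.val j.val (l.val - 1), by
            have h1 := l.isLt
            simp only [skipTwo]; split_ifs <;> omega⟩)
      else 0

end PolyDer

section Contraction

variable {S : Type*}

/-- Insertion of `a` as the first argument of `P`. -/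
def contractFirst {m : ℕ} (P : (Fin (m + 1) → S) → S) (a : S) : (Fin m → S) → S :=
  fun y => P (Fin.cons a y)

lemma contractFirst_update {m : ℕ} (P : (Fin (m + 1) → S) → S) (a : S) (y : Fin m → S)
    (i : Fin m) (x : S) :
    contractFirst P a (Function.update y i x) =
      P (Function.update (Fin.cons a y : Fin (m + 1) → S) i.succ x) := by
  simp only [contractFirst, Fin.cons_update]

variable [CommRing S]

lemma IsSkewSym.apply_swap {m : ℕ} {P : (Fin m → S) → S} (hP : IsSkewSym S m P)
    {i j : Fin m} (hij : i ≠ j) (y : Fin m → S) :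
    P (fun l => y (Equiv.swap i j l)) = -P y := by
  rw [hP (Equiv.swap i j) y, Equiv.Perm.sign_swap hij]
  simp

lemma isSkewSym_contractFirst {m : ℕ} {P : (Fin (m + 1) → S) → S}
    (hP : IsSkewSym S (m + 1) P) (a : S) : IsSkewSym S m (contractFirst P a) := by
  intro θ y
  have h := hP (Equiv.Perm.decomposeFin.symm (0, θ)) (Fin.cons a y)
  rw [Equiv.Perm.decomposeFin.symm_sign] at h
  simp only [contractFirst]
  rw [h]
  simp only [if_true, one_mul]
  congr 2
  funext l
  refine Fin.cases ?_ (fun t => ?_) l <;> simp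

lemma isPolyDer_contractFirst {k : Type*} [Field k] [Algebra k S] {m : ℕ}
    {P : (Fin (m + 1) → S) → S} (hP : IsPolyDer k S (m + 1) P) (a : S) :
    IsPolyDer k S m (contractFirst P a) := by
  obtain ⟨⟨hadd, hsmul⟩, hskew, hder⟩ := hP
  refine ⟨⟨fun y i u v => ?_, fun y i c u => ?_⟩, isSkewSym_contractFirst hskew a,
    fun y i u v => ?_⟩ <;> simp only [contractFirst_update]
  exacts [hadd _ _ _ _, hsmul _ _ _ _, hder _ _ _ _]

/-- In a skew-symmetric map, an argument can be moved to the first place. -/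
lemma IsSkewSym.cons_removeNth {m : ℕ} {P : (Fin (m + 1) → S) → S}
    (hP : IsSkewSym S (m + 1) P) (j : Fin (m + 1)) (b : S) (y : Fin (m + 1) → S) :
    P (Fin.cons b (j.removeNth y)) = (-1 : ℤ) ^ (j : ℕ) • P (Function.update y j b) := by
  rw [hP j.cycleRange, Fin.sign_cycleRange]
  have h : (fun l => (Fin.cons b (j.removeNth y) : Fin (m + 1) → S) (j.cycleRange l)) =
      Function.update y j b := by
    rw [← Fin.insertNth_removeNth]
    exact Fin.cons_comp_cycleRange _ _ _
  rw [h]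
  push_cast
  rfl

lemma IsSkewSym.cons_cons_swap {m : ℕ} {P : (Fin (m + 2) → S) → S}
    (hP : IsSkewSym S (m + 2) P) (a b : S) (z : Fin m → S) :
    P (Fin.cons a (Fin.cons b z : Fin (m + 1) → S)) =
      -P (Fin.cons b (Fin.cons a z : Fin (m + 1) → S)) := by
  rw [← IsSkewSym.apply_swap hP (i := 0) (j := 1) (by simp)]
  congr 1
  funext l
  refine Fin.cases ?_ (fun t => ?_) l
  · rw [Equiv.swap_apply_left]; rfl
  · refine Fin.cases ?_ (fun t => ?_) t
    · rw [show (Fin.succ 0 : Fin (m + 2)) = 1 from rfl, Equiv.swap_apply_right]; rfl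
    · rw [Equiv.swap_apply_of_ne_of_ne (Fin.succ_ne_zero _)
        (by rw [← Fin.succ_zero_eq_one]; simp [Fin.ext_iff])]
      rfl

/-- Skew-symmetry may be checked on the first two arguments and on the tail. -/
lemma isSkewSym_of_cons {m : ℕ} {P : (Fin (m + 2) → S) → S}
    (hswap : ∀ (a b : S) (z : Fin m → S),
      P (Fin.cons a (Fin.cons b z : Fin (m + 1) → S)) =
        -P (Fin.cons b (Fin.cons a z : Fin (m + 1) → S)))
    (htail : ∀ a, IsSkewSym S (m + 1) (contractFirst P a)) : IsSkewSym S (m + 2) P := by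
  have hadj : ∀ (i : Fin (m + 1)) (y : Fin (m + 2) → S),
      P y = -P (fun l => y (Equiv.swap i.castSucc i.succ l)) := by
    intro i y
    refine Fin.cases ?_ (fun i => ?_) i
    · obtain ⟨a, y, rfl⟩ : ∃ a t, y = Fin.cons a t := ⟨_, _, (Fin.cons_self_tail y).symm⟩
      obtain ⟨b, z, rfl⟩ : ∃ a t, y = Fin.cons a t := ⟨_, _, (Fin.cons_self_tail y).symm⟩
      rw [hswap]
      congr 2
      funext l
      rw [Fin.castSucc_zero]
      refine Fin.cases ?_ (fun t => ?_) l
      · rw [Equiv.swap_apply_left]; rfl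
      · refine Fin.cases ?_ (fun t => ?_) t
        · rw [Equiv.swap_apply_right]; rfl
        · rw [Equiv.swap_apply_of_ne_of_ne (Fin.succ_ne_zero _) (by simp [Fin.ext_iff])]
          rfl
    · obtain ⟨a, y, rfl⟩ : ∃ a t, y = Fin.cons a t := ⟨_, _, (Fin.cons_self_tail y).symm⟩
      have h := IsSkewSym.apply_swap (htail a) (i := i.castSucc) (j := i.succ)
        (by simp [Fin.ext_iff]) y
      simp only [contractFirst] at h
      rw [eq_neg_iff_add_eq_zero, ← eq_neg_iff_add_eq_zero, eq_neg_iff_add_eq_zero, add_comm,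
        ← eq_neg_iff_add_eq_zero, ← h]
      congr 1
      funext l
      refine Fin.cases ?_ (fun t => ?_) l
      · rw [Equiv.swap_apply_of_ne_of_ne (by simp [Fin.ext_iff]) (by simp [Fin.ext_iff])]
        rfl
      · rw [← Fin.succ_castSucc, ← (Fin.succ_injective _).map_swap]
        rfl
  intro θ
  have hθ : θ ∈ Submonoid.closure
      (Set.range fun i : Fin (m + 1) => Equiv.swap i.castSucc i.succ) := by
    rw [Equiv.Perm.mclosure_swap_castSucc_succ]; trivial
  induction hθ using Submonoid.closure_induction with
  | mem θ h =>
    obtain ⟨i, rfl⟩ := h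
    intro y
    rw [Equiv.Perm.sign_swap (by simp [Fin.ext_iff]), hadj i y]
    simp
  | one => intro y; simp
  | mul θ η _ _ hθ hη =>
    intro y
    rw [hθ y, hη (fun i => y (θ i)), smul_smul, Equiv.Perm.sign_mul]
    simp

/-- A skew-symmetric map satisfies any identity in one argument as soon as it satisfies it in
some fixed argument. -/
lemma IsSkewSym.exists_update_eq {m : ℕ} {P : (Fin m → S) → S} (hP : IsSkewSym S m P)
    (i j : Fin m) (y : Fin m → S) :
    ∃ (ε : ℤ) (y' : Fin m → S), ∀ x, P (Function.update y i x) =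
      ε • P (Function.update y' j x) := by
  refine ⟨(Equiv.Perm.sign (Equiv.swap i j) : ℤ), y ∘ Equiv.swap i j, fun x => ?_⟩
  rw [hP (Equiv.swap i j)]
  congr 2
  have h := Function.update_comp_equiv y (Equiv.swap i j) i x
  rw [Equiv.symm_swap, Equiv.swap_apply_left] at h
  exact h

end Contraction

section LieDerivative

variable {k : Type*} [Field k] {S : Type*} [CommRing S] [Algebra k S]

/-- The Lie derivative of `P` along the Hamiltonian derivation `{a, -}`. -/
def hamLie (br : S →ₗ[k] S →ₗ[k] S) {m : ℕ} (a : S) (P : (Fin m → S) → S) :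
    (Fin m → S) → S := fun y =>
  br a (P y) - ∑ j, P (Function.update y j (br a (y j)))

lemma hamLie_update (br : S →ₗ[k] S →ₗ[k] S) {m : ℕ} (a : S) (P : (Fin m → S) → S)
    (y : Fin m → S) (i : Fin m) (x : S) :
    hamLie br a P (Function.update y i x) =
      br a (P (Function.update y i x)) - (P (Function.update y i (br a x)) +
        ∑ j ∈ Finset.univ.erase i,
          P (Function.update (Function.update y j (br a (y j))) i x)) := by
  rw [hamLie, ← Finset.add_sum_erase _ _ (Finset.mem_univ i)]
  congr 2
  · simp
  · refine Finset.sum_congr rfl fun j hj => ?_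
    have hne := Finset.ne_of_mem_erase hj
    rw [Function.update_of_ne hne, Function.update_comm hne]

lemma isSkewSym_hamLie (br : S →ₗ[k] S →ₗ[k] S) {m : ℕ} (a : S) {P : (Fin m → S) → S}
    (hP : IsSkewSym S m P) : IsSkewSym S m (hamLie br a P) := by
  intro θ y
  simp only [hamLie]
  rw [smul_sub, Finset.smul_sum, ← map_zsmul (br a), ← hP θ y, ← Equiv.sum_comp θ]
  congr 1
  refine Finset.sum_congr rfl fun j _ => ?_
  rw [hP θ]
  congr 2
  have h := Function.update_comp_equiv y θ (θ j) (br a (y (θ j)))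
  rw [Equiv.symm_apply_apply] at h
  exact h

lemma isPolyDer_hamLie (br : S →ₗ[k] S →ₗ[k] S)
    (hleib : ∀ a b c : S, br a (b * c) = br a b * c + br a c * b)
    {m : ℕ} (a : S) {P : (Fin m → S) → S} (hP : IsPolyDer k S m P) :
    IsPolyDer k S m (hamLie br a P) := by
  obtain ⟨⟨hadd, hsmul⟩, hskew, hder⟩ := hP
  refine ⟨⟨fun y i u v => ?_, fun y i c u => ?_⟩, isSkewSym_hamLie br a hskew,
    fun y i u v => ?_⟩ <;> simp only [hamLie_update]
  · simp only [hadd, map_add, Finset.sum_add_distrib]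
    ring
  · simp only [hsmul, map_smul, ← Finset.smul_sum, smul_sub, smul_add]
  · unfold IsMultiDer at hder
    simp only [hder, hleib, hadd, map_add, Finset.sum_add_distrib, ← Finset.mul_sum]
    ring

lemma hamLie_cons (br : S →ₗ[k] S →ₗ[k] S) {m : ℕ} (a b : S) (P : (Fin (m + 1) → S) → S)
    (z : Fin m → S) :
    hamLie br a P (Fin.cons b z) =
      hamLie br a (contractFirst P b) z - P (Fin.cons (br a b) z) := by
  simp only [hamLie, Fin.sum_univ_succ, contractFirst, Fin.cons_zero, Fin.cons_succ,
    Fin.update_cons_zero, ← Fin.cons_update]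
  ring

lemma pDelta_neg (br : S →ₗ[k] S →ₗ[k] S) {m : ℕ} (P : (Fin m → S) → S)
    (y : Fin (m + 1) → S) : pDelta k S br m (fun z => -P z) y = -pDelta k S br m P y := by
  simp only [pDelta, map_neg, smul_neg, Finset.sum_neg_distrib, neg_add]
  congr 1
  simp only [← Finset.sum_neg_distrib]
  refine Finset.sum_congr rfl fun i _ => Finset.sum_congr rfl fun j _ => ?_
  split_ifs <;> simp

lemma pDelta_zero_apply (br : S →ₗ[k] S →ₗ[k] S) (P : (Fin 0 → S) → S) (y : Fin 1 → S) :
    pDelta k S br 0 P y = br (y 0) (P Fin.elim0) := by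
  simp [pDelta, Subsingleton.elim (fun l : Fin 0 => y l.succ) Fin.elim0]

/-- Cartan's formula. -/
lemma pDelta_cons (br : S →ₗ[k] S →ₗ[k] S) {m : ℕ} {P : (Fin (m + 1) → S) → S}
    (hP : IsSkewSym S (m + 1) P) (a : S) (z : Fin (m + 1) → S) :
    pDelta k S br (m + 1) P (Fin.cons a z) =
      hamLie br a P z - pDelta k S br m (contractFirst P a) z := by
  have h1 : ∀ i : Fin (m + 1), (fun l => (Fin.cons a z : Fin (m + 2) → S) (i.succ.succAbove l)) =
      Fin.cons a (fun l => z (i.succAbove l)) := by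
    intro i
    funext l
    refine Fin.cases ?_ (fun t => ?_) l <;> simp
  simp only [pDelta, hamLie]
  have h2 : ∀ (j : Fin (m + 1)) (c : S) (p : ∀ l : Fin (m + 1), ¬ (l : ℕ) = 0 →
      skipTwo 0 (j + 1) (l - 1) < m + 2),
      (fun l : Fin (m + 1) => if h0 : (l : ℕ) = 0 then c else
        (Fin.cons a z : Fin (m + 2) → S) ⟨skipTwo 0 (j + 1) (l - 1), p l h0⟩) =
      Fin.cons c (j.removeNth z) := by
    intro j c p
    funext l
    refine Fin.cases ?_ (fun t => ?_) l
    · simp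
    · simp only [Fin.val_succ, Nat.add_eq_zero_iff, one_ne_zero, and_false, dite_false,
        Fin.cons_succ, Fin.removeNth, Nat.add_sub_cancel]
      rw [← Fin.cons_succ (α := fun _ => S) a z]
      congr 1
      ext
      simp only [skipTwo, Fin.succAbove, Fin.lt_def, Fin.val_castSucc]
      split_ifs <;> simp_all
  have h3 : ∀ (i j : Fin (m + 1)), i < j → ∀ (c : S) (p : ∀ l : Fin (m + 1), ¬ (l : ℕ) = 0 →
      skipTwo (i + 1) (j + 1) (l - 1) < m + 2) (q : ∀ l : Fin m, ¬ (l : ℕ) = 0 →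
      skipTwo i j (l - 1) < m + 1),
      P (fun l : Fin (m + 1) => if h0 : (l : ℕ) = 0 then c else
        (Fin.cons a z : Fin (m + 2) → S) ⟨skipTwo (i + 1) (j + 1) (l - 1), p l h0⟩) =
      -contractFirst P a (fun l : Fin m => if h0 : (l : ℕ) = 0 then c else
        z ⟨skipTwo i j (l - 1), q l h0⟩) := by
    intro i j hij c p q
    obtain _ | m := m
    · omega
    have h := hP.cons_cons_swap a c
      (fun t : Fin m => z ⟨skipTwo i j t, by simpa using q t.succ (by simp)⟩)
    rw [contractFirst, ← neg_eq_iff_eq_neg]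
    refine Eq.trans (Eq.trans ?_ h.symm) ?_
    · congr 2
      funext l
      refine Fin.cases (by simp) (fun t => Fin.cases ?_ (fun t => ?_) t) l
      · simp [skipTwo]
      · simp only [Fin.val_succ, Nat.add_eq_zero_iff, one_ne_zero, and_false, dite_false,
          Fin.cons_succ, Nat.add_sub_cancel]
        rw [← Fin.cons_succ (α := fun _ => S) a z]
        congr 1
        ext
        simp only [skipTwo, Fin.val_succ]
        split_ifs <;> omega
    · congr 2
      funext l
      refine Fin.cases (by simp) (fun t => ?_) l
      simp
  have h4 : ∀ j : Fin (m + 1),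
      (-1 : ℤ) ^ ((j : ℕ) + 1) • P (Fin.cons (br a (z j)) (j.removeNth z)) =
        -P (Function.update z j (br a (z j))) := by
    intro j
    rw [hP.cons_removeNth, smul_smul, pow_succ, mul_right_comm, ← mul_pow]
    simp
  simp only [Fin.sum_univ_succ (n := m + 1), h1, Fin.cons_zero, Fin.cons_succ,
    Fin.succAbove_zero, if_false, Fin.succ_pos, Fin.not_lt_zero, if_true,
    zero_add, Fin.succ_lt_succ_iff, Fin.val_zero, Fin.val_succ, h2, h4, pow_zero, one_smul]
  have h5 : ∀ i : Fin (m + 1),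
      (-1 : ℤ) ^ ((i : ℕ) + 1) • br (z i) (P (Fin.cons a fun l => z (i.succAbove l))) =
        -((-1 : ℤ) ^ (i : ℕ) • br (z i) (contractFirst P a fun l => z (i.succAbove l))) := by
    intro i
    rw [pow_succ, mul_neg_one, neg_smul, contractFirst]
  have h6 : ∀ i j : Fin (m + 1), (-1 : ℤ) ^ ((i : ℕ) + 1 + (j + 1)) = (-1) ^ ((i : ℕ) + j) := by
    intro i j
    rw [add_add_add_comm, pow_add]
    simp
  simp only [h5, h6, Finset.sum_neg_distrib]
  have h7 : ∀ A B C D E : S, D = -E → A + -B + (-C + D) = A - C - (B + E) := by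
    rintro A B C _ E rfl
    ring
  refine h7 _ _ _ _ _ ?_
  simp only [← Finset.sum_neg_distrib]
  refine Finset.sum_congr rfl fun i _ => Finset.sum_congr rfl fun j _ => ?_
  split_ifs with hij
  · rw [h3 i j hij, smul_neg]
  · simp

end LieDerivative

/-- the Poisson coboundary of an element of `𝔛^m(S)` lies in
`𝔛^{m+1}(S)`: it is again multilinear, skew-symmetric and a derivation in each
argument. -/
theorem pDelta_mem_polyDer
    (k : Type*) [Field k] (S : Type*) [CommRing S] [Algebra k S]
    (br : S →ₗ[k] S →ₗ[k] S)
    (hanti : ∀ a b : S, br a b = - br b a)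
    (hjacobi : ∀ a b c : S, br a (br b c) + br b (br c a) + br c (br a b) = 0)
    (hleib : ∀ a b c : S, br a (b * c) = br a b * c + br a c * b)
    (m : ℕ) (P : (Fin m → S) → S) (hP : IsPolyDer k S m P) :
    IsPolyDer k S (m+1) (pDelta k S br m P) := by
  induction m with
  | zero =>
    simp only [IsPolyDer, IsMultilin, IsSkewSym, IsMultiDer, pDelta_zero_apply]
    refine ⟨⟨fun y i u v => ?_, fun y i c u => ?_⟩, fun θ y => ?_, fun y i u v => ?_⟩
    · simp [Subsingleton.elim (α := Fin 1) i 0]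
    · simp [Subsingleton.elim (α := Fin 1) i 0]
    · simp [Subsingleton.elim (α := Equiv.Perm (Fin 1)) θ 1]
    · simp only [Subsingleton.elim (α := Fin 1) i 0, Function.update_self]
      rw [hanti, hleib, hanti u, hanti v]
      ring
  | succ m ih =>
    have htail : ∀ a, IsPolyDer k S (m + 1) (contractFirst (pDelta k S br (m + 1) P) a) := by
      intro a
      obtain ⟨⟨hadd, hsmul⟩, hskew, hder⟩ := isPolyDer_hamLie br hleib a hP
      obtain ⟨⟨hadd', hsmul'⟩, hskew', hder'⟩ := ih _ (isPolyDer_contractFirst hP a)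
      refine ⟨⟨fun y i u v => ?_, fun y i c u => ?_⟩, fun θ y => ?_, fun y i u v => ?_⟩ <;>
        simp only [contractFirst, pDelta_cons br hP.2.1]
      · rw [hadd, hadd']; ring
      · rw [hsmul, hsmul', smul_sub]
      · rw [hskew θ, hskew' θ, smul_sub]
      · rw [hder, hder']; ring
    have hskew : IsSkewSym S (m + 2) (pDelta k S br (m + 1) P) := by
      refine isSkewSym_of_cons (fun a b z => ?_) fun a => (htail a).2.1
      rw [pDelta_cons br hP.2.1, pDelta_cons br hP.2.1, hamLie_cons, hamLie_cons, hanti b a]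
      have hneg : P (Fin.cons (-br a b) z) = -P (Fin.cons (br a b) z) := by
        have h := hP.1.2 (Fin.cons 0 z) 0 (-1) (br a b)
        simpa [Fin.update_cons_zero] using h
      rw [hneg]
      cases m with
      | zero =>
        simp only [pDelta_zero_apply, hamLie, contractFirst, Fin.cons_zero,
          Subsingleton.elim z Fin.elim0]
        simp
        ring
      | succ m =>
        have hc := isPolyDer_contractFirst hP
        rw [pDelta_cons br (hc a).2.1, pDelta_cons br (hc b).2.1]
        have h : contractFirst (contractFirst P a) b =
            fun y => -contractFirst (contractFirst P b) a y := by
          funext y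
          exact hP.2.1.cons_cons_swap a b y
        rw [h, pDelta_neg]
        ring
    refine ⟨⟨fun y i u v => ?_, fun y i c u => ?_⟩, hskew, fun y i u v => ?_⟩ <;>
      obtain ⟨ε, y', h⟩ := hskew.exists_update_eq i (Fin.succ 0) y <;>
      rw [← Fin.cons_self_tail y'] at h <;>
      simp only [h, ← contractFirst_update]
    · rw [(htail _).1.1, smul_add]
    · rw [(htail _).1.2, smul_comm]
    · rw [(htail _).2.2, smul_add, mul_smul_comm, mul_smul_comm]
end

section
/- Let S be a Frobenius Poisson algebra over a field k with nondegenerate associative symmetric bilinear form ⟨-,-⟩, let m ≥ 1 and P ∈ 𝔛^m(S). If Q' : S^{m−1} → S is an (m−1)-multilinear map satisfying ⟨Q'(a_1, …, a_{m−1}), a_m⟩ = (−1)^{m−1} ⟨P(a_1, …, a_{m−1}, a_m), 1⟩ for all a_1, …, a_m ∈ S, then Q' ∈ 𝔛^{m−1}(S), i.e. Q' is skew-symmetric and a derivation in each argument. (Thus the operator Δ : 𝔛^m(S) → 𝔛^{m−1}(S), Δ(P) := Q', is well defined.) -/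
section PolyDer

variable {k : Type*} [Field k] {S : Type*} [CommRing S] [Algebra k S] {p : ℕ}

/-- A skew-symmetric map is skew-symmetric in the arguments preceding a fixed last one. -/
theorem IsSkewSym.snoc_comp_perm {P : (Fin (p + 1) → S) → S} (hP : IsSkewSym S (p + 1) P)
    (θ : Equiv.Perm (Fin p)) (a : Fin p → S) (x : S) :
    P (Fin.snoc a x) = (Equiv.Perm.sign θ : ℤ) • P (Fin.snoc (fun i => a (θ i)) x) := by
  have h := hP (finSuccEquivLast.symm.permCongr (Equiv.optionCongr θ)) (Fin.snoc a x)
  rw [Equiv.Perm.sign_permCongr, Equiv.optionCongr_sign] at h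
  rw [h]
  congr 2
  funext j
  refine Fin.lastCases ?_ (fun i => ?_) j <;> simp [Equiv.permCongr_apply]

/-- Exchanging the last argument of a skew-symmetric map with another one changes the sign. -/
theorem IsSkewSym.snoc_update_swap {P : (Fin (p + 1) → S) → S} (hP : IsSkewSym S (p + 1) P)
    (a : Fin p → S) (i : Fin p) (x y : S) :
    P (Fin.snoc (Function.update a i x) y) = -P (Fin.snoc (Function.update a i y) x) := by
  rw [hP (Equiv.swap i.castSucc (Fin.last p)),
    Equiv.Perm.sign_swap (Fin.castSucc_lt_last i).ne]
  simp only [Units.val_neg, Units.val_one, neg_smul, one_smul]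
  congr 2
  funext j
  refine Fin.lastCases ?_ (fun l => ?_) j
  · simp
  · by_cases h : l = i
    · simp [h]
    · rw [Equiv.swap_apply_of_ne_of_ne (by simpa using h) (Fin.castSucc_lt_last l).ne]
      simp [h]

theorem IsMultiDer.snoc_mul {P : (Fin (p + 1) → S) → S} (hP : IsMultiDer S (p + 1) P)
    (a : Fin p → S) (x y : S) :
    P (Fin.snoc a (x * y)) = x * P (Fin.snoc a y) + y * P (Fin.snoc a x) := by
  simpa only [Fin.update_snoc_last] using hP (Fin.snoc a 0) (Fin.last p) x y

theorem IsMultiDer.snoc_update_mul {P : (Fin (p + 1) → S) → S} (hP : IsMultiDer S (p + 1) P)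
    (a : Fin p → S) (i : Fin p) (x y z : S) :
    P (Fin.snoc (Function.update a i (x * y)) z) =
      x * P (Fin.snoc (Function.update a i y) z) +
        y * P (Fin.snoc (Function.update a i x) z) := by
  simpa only [Fin.snoc_update] using hP (Fin.snoc a z) i.castSucc x y

/-- The derivation rule in an inner argument, with the outer factors moved into the last one. -/
theorem IsPolyDer.snoc_update_mul_eq_add {P : (Fin (p + 1) → S) → S}
    (hP : IsPolyDer k S (p + 1) P) (a : Fin p → S) (i : Fin p) (x y z : S) :
    P (Fin.snoc (Function.update a i (x * y)) z) =
      P (Fin.snoc (Function.update a i y) (x * z)) +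
        P (Fin.snoc (Function.update a i x) (y * z)) := by
  obtain ⟨-, hskew, hder⟩ := hP
  rw [hder.snoc_update_mul, hder.snoc_mul, hder.snoc_mul, hskew.snoc_update_swap a i y x]
  ring

end PolyDer

/-- the BV operator `Δ` is well defined: if `P ∈ 𝔛^m(S)`
(`m = p+1 ≥ 1`) and the `(m−1)`-multilinear map `Q'` satisfies
`⟨Q'(a_1, …, a_{m−1}), a_m⟩ = (−1)^{m−1} ⟨P(a_1, …, a_m), 1⟩`, then
`Q' ∈ 𝔛^{m−1}(S)`. -/
theorem bv_operator_well_defined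
    (k : Type*) [Field k] (S : Type*) [CommRing S] [Algebra k S]
    [FiniteDimensional k S]
    -- the Poisson bracket on S, k-bilinear
    (br : S →ₗ[k] S →ₗ[k] S)
    (hanti : ∀ a b : S, br a b = - br b a)
    (hjacobi : ∀ a b c : S, br a (br b c) + br b (br c a) + br c (br a b) = 0)
    (hleib : ∀ a b c : S, br a (b * c) = br a b * c + br a c * b)
    -- the Frobenius bilinear form ⟨-,-⟩, nondegenerate, associative, symmetric
    (B : S →ₗ[k] S →ₗ[k] k)
    (hBnd : ∀ a : S, (∀ b : S, B a b = 0) → a = 0)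
    (hBassoc : ∀ a b c : S, B (a * b) c = B a (b * c))
    (hBsymm : ∀ a b : S, B a b = B b a)
    -- P ∈ 𝔛^{p+1}(S)
    (p : ℕ) (P : (Fin (p+1) → S) → S) (hP : IsPolyDer k S (p+1) P)
    -- Q' is (p)-multilinear and pairs as prescribed
    (Q' : (Fin p → S) → S) (hQ'multi : IsMultilin k S p Q')
    (hQ'pair : ∀ (a : Fin p → S) (x : S),
      B (Q' a) x = (-1 : ℤ)^p • B (P (Fin.snoc a x)) 1) :
    IsPolyDer k S p Q' := by
  have ext_left : ∀ u v : S, (∀ z, B u z = B v z) → u = v := fun u v h =>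
    sub_eq_zero.mp (hBnd _ fun z => by rw [map_sub, LinearMap.sub_apply, h, sub_self])
  refine ⟨hQ'multi, fun θ a => ext_left _ _ fun z => ?_, fun a i x y => ext_left _ _ fun z => ?_⟩
  · rw [map_zsmul, LinearMap.smul_apply, hQ'pair, hQ'pair, hP.2.1.snoc_comp_perm θ, map_zsmul,
      LinearMap.smul_apply, smul_comm]
  · rw [map_add, LinearMap.add_apply, mul_comm x (Q' _), mul_comm y (Q' _), hBassoc, hBassoc,
      hQ'pair, hQ'pair, hQ'pair, hP.snoc_update_mul_eq_add, map_add, LinearMap.add_apply, smul_add]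
end

section
/- Let S be a Frobenius Poisson algebra over a field k with nondegenerate associative symmetric bilinear form ⟨-,-⟩, let m ≥ 2 and P ∈ 𝔛^m(S). Suppose D P : S^{m−1} → S satisfies ⟨DP(a_1, …, a_{m−1}), a_m⟩ = (−1)^{m−1} ⟨P(a_1, …, a_m), 1⟩ for all a_i ∈ S, and D D P : S^{m−2} → S satisfies ⟨DDP(a_1, …, a_{m−2}), a_{m−1}⟩ = (−1)^{m−2} ⟨DP(a_1, …, a_{m−1}), 1⟩ for all a_i ∈ S. Then DDP = 0; that is, the operator Δ defined by these equations satisfies Δ² = 0 on 𝔛(S). -/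
/-- A map that is a derivation in each argument vanishes when an argument is `1`. -/
theorem IsMultiDer.update_one {S : Type*} [CommRing S] {m : ℕ} {P : (Fin m → S) → S}
    (hP : IsMultiDer S m P) (a : Fin m → S) (i : Fin m) :
    P (Function.update a i 1) = 0 := by
  simpa using hP a i 1 1

/-- the BV operator squares to zero: if `P ∈ 𝔛^m(S)`
(`m = r+2 ≥ 2`), `DP` satisfies the defining pairing property of `Δ(P)`, and
`DDP` satisfies the defining pairing property of `Δ(Δ(P))`, then `DDP = 0`. -/
theorem bv_operator_squares_to_zero
    (k : Type*) [Field k] (S : Type*) [CommRing S] [Algebra k S]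
    [FiniteDimensional k S]
    -- the Poisson bracket on S, k-bilinear
    (br : S →ₗ[k] S →ₗ[k] S)
    (hanti : ∀ a b : S, br a b = - br b a)
    (hjacobi : ∀ a b c : S, br a (br b c) + br b (br c a) + br c (br a b) = 0)
    (hleib : ∀ a b c : S, br a (b * c) = br a b * c + br a c * b)
    -- the Frobenius bilinear form ⟨-,-⟩, nondegenerate, associative, symmetric
    (B : S →ₗ[k] S →ₗ[k] k)
    (hBnd : ∀ a : S, (∀ b : S, B a b = 0) → a = 0)
    (hBassoc : ∀ a b c : S, B (a * b) c = B a (b * c))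
    (hBsymm : ∀ a b : S, B a b = B b a)
    -- P ∈ 𝔛^{r+2}(S),  m = r+2 ≥ 2
    (r : ℕ) (P : (Fin (r+2) → S) → S) (hP : IsPolyDer k S (r+2) P)
    -- ⟨DP(a_1, …, a_{m−1}), a_m⟩ = (−1)^{m−1} ⟨P(a_1, …, a_m), 1⟩
    (DP : (Fin (r+1) → S) → S)
    (hDP : ∀ (a : Fin (r+1) → S) (x : S),
      B (DP a) x = (-1 : ℤ)^(r+1) • B (P (Fin.snoc a x)) 1)
    -- ⟨DDP(a_1, …, a_{m−2}), a_{m−1}⟩ = (−1)^{m−2} ⟨DP(a_1, …, a_{m−1}), 1⟩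
    (DDP : (Fin r → S) → S)
    (hDDP : ∀ (a : Fin r → S) (x : S),
      B (DDP a) x = (-1 : ℤ)^r • B (DP (Fin.snoc a x)) 1) :
    DDP = 0 := by
  funext a
  refine hBnd _ fun x => ?_
  have hone (b : Fin (r+1) → S) : P (Fin.snoc b 1) = 0 := by
    have hlast : Function.update (Fin.snoc b 0 : Fin (r+2) → S) (Fin.last (r+1)) 1 =
        Fin.snoc b 1 := Fin.update_snoc_last ..
    rw [← hlast]
    exact hP.2.2.update_one _ _
  rw [hDDP, hDP, hone]
  simp
end

section
/- (BV relation on polyderivations.) Let S be a Frobenius Poisson algebra over a field k with nondegenerate associative symmetric bilinear form ⟨-,-⟩, let m, n ≥ 1, P ∈ 𝔛^m(S), Q ∈ 𝔛^n(S). Suppose DP : S^{m−1} → S, DQ : S^{n−1} → S and DPQ : S^{m+n−1} → S satisfy ⟨DP(a_1,…,a_{m−1}), a_m⟩ = (−1)^{m−1} ⟨P(a_1,…,a_m), 1⟩, ⟨DQ(a_1,…,a_{n−1}), a_n⟩ = (−1)^{n−1} ⟨Q(a_1,…,a_n), 1⟩, and ⟨DPQ(a_1,…,a_{m+n−1}),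 a_{m+n}⟩ = (−1)^{m+n−1} ⟨(P∧Q)(a_1,…,a_{m+n}), 1⟩, for all a_i ∈ S. Then [P, Q]_S = −(−1)^{(m−1)n} (DPQ − DP∧Q − (−1)^m P∧DQ) as maps S^{m+n−1} → S. -/
section Shuffles

variable (k : Type*) [Field k] (S : Type*) [CommRing S] [Algebra k S]

/-- `θ` is a `(p, r−p)`-shuffle: `θ` is increasing on `{0, …, p−1}` and on
`{p, …, r−1}` (0-based indexing). -/
def IsShuffle {r : ℕ} (p : ℕ) (θ : Equiv.Perm (Fin r)) : Prop :=
  ∀ i j : Fin r, i < j → ((j : ℕ) < p ∨ p ≤ (i : ℕ)) → θ i < θ j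

instance {r : ℕ} (p : ℕ) (θ : Equiv.Perm (Fin r)) : Decidable (IsShuffle p θ) := by
  unfold IsShuffle; infer_instance

/-- The wedge product
`(P∧Q)(a_1,…,a_r) = Σ_{θ ∈ S_{m,n}} ε(θ) P(a_{θ(1)},…,a_{θ(m)}) Q(a_{θ(m+1)},…,a_{θ(m+n)})`
of multilinear maps `P : S^m → S` and `Q : S^n → S`, with `r = m + n`. -/
noncomputable def wedgeProd (m n r : ℕ) (h : m + n = r)
    (P : (Fin m → S) → S) (Q : (Fin n → S) → S) : (Fin r → S) → S := fun a =>
  ∑ θ : Equiv.Perm (Fin r),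
    if IsShuffle m θ then
      (Equiv.Perm.sign θ : ℤ) •
        (P (fun i => a (θ ⟨(i : ℕ), by have := i.isLt; omega⟩)) *
         Q (fun j => a (θ ⟨m + (j : ℕ), by have := j.isLt; omega⟩)))
    else 0

/-- The partial wedge product `P ∧₁ Q`: only the shuffles with `θ(m) = m+n`
(`1`-based), i.e. `θ(m−1) = r−1` (0-based), contribute. -/
noncomputable def wedgeFstProd (m n r : ℕ) (h : m + n = r) (hm : 1 ≤ m)
    (P : (Fin m → S) → S) (Q : (Fin n → S) → S) : (Fin r → S) → S := fun a =>
  ∑ θ : Equiv.Perm (Fin r),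
    if IsShuffle m θ ∧ θ ⟨m - 1, by omega⟩ = ⟨r - 1, by omega⟩ then
      (Equiv.Perm.sign θ : ℤ) •
        (P (fun i => a (θ ⟨(i : ℕ), by have := i.isLt; omega⟩)) *
         Q (fun j => a (θ ⟨m + (j : ℕ), by have := j.isLt; omega⟩)))
    else 0

/-- The partial wedge product `P ∧₂ Q`: only the shuffles with
`θ(m+n) = m+n` (`1`-based), i.e. `θ(r−1) = r−1` (0-based), contribute. -/
noncomputable def wedgeSndProd (m n r : ℕ) (h : m + n = r) (hm : 1 ≤ m)
    (P : (Fin m → S) → S) (Q : (Fin n → S) → S) : (Fin r → S) → S := fun a =>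
  ∑ θ : Equiv.Perm (Fin r),
    if IsShuffle m θ ∧ θ ⟨r - 1, by omega⟩ = ⟨r - 1, by omega⟩ then
      (Equiv.Perm.sign θ : ℤ) •
        (P (fun i => a (θ ⟨(i : ℕ), by have := i.isLt; omega⟩)) *
         Q (fun j => a (θ ⟨m + (j : ℕ), by have := j.isLt; omega⟩)))
    else 0

/-- The circle product
`(P∘Q)(a_1,…,a_r) = Σ_{θ ∈ S_{n,m−1}} ε(θ) P(Q(a_{θ(1)},…,a_{θ(n)}), a_{θ(n+1)},…,a_{θ(n+m−1)})`
of multilinear maps `P : S^m → S` and `Q : S^n → S`, with `r = m + n − 1`,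
`m ≥ 1`. -/
noncomputable def circProd (m n r : ℕ) (h : m + n = r + 1) (hm : 1 ≤ m)
    (P : (Fin m → S) → S) (Q : (Fin n → S) → S) : (Fin r → S) → S := fun a =>
  ∑ θ : Equiv.Perm (Fin r),
    if IsShuffle n θ then
      (Equiv.Perm.sign θ : ℤ) • P (fun l =>
        if h0 : (l : ℕ) = 0 then
          Q (fun i => a (θ ⟨(i : ℕ), by have := i.isLt; omega⟩))
        else a (θ ⟨n + ((l : ℕ) - 1), by have := l.isLt; omega⟩))
    else 0

end Shuffles

section ShuffleSums

variable {M : Type*} [AddCommGroup M]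

/-- The signed sum of `F` over the `(m, r−m)`-shuffles of `Fin r`. -/
def shuffleSum {r : ℕ} (m : ℕ) (F : Equiv.Perm (Fin r) → M) : M :=
  ∑ θ : Equiv.Perm (Fin r), if IsShuffle m θ then (Equiv.Perm.sign θ : ℤ) • F θ else 0

theorem map_shuffleSum {N : Type*} [AddCommGroup N] (f : M →+ N) {r : ℕ} (m : ℕ)
    (F : Equiv.Perm (Fin r) → M) : f (shuffleSum m F) = shuffleSum m fun θ => f (F θ) := by
  simp only [shuffleSum, map_sum, apply_ite f, map_zsmul, map_zero]

theorem shuffleSum_add {r : ℕ} (m : ℕ) (F G : Equiv.Perm (Fin r) → M) :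
    shuffleSum m (fun θ => F θ + G θ) = shuffleSum m F + shuffleSum m G := by
  simp only [shuffleSum, ← Finset.sum_add_distrib, smul_add, ← ite_add_zero]

theorem shuffleSum_zsmul {r : ℕ} (m : ℕ) (c : ℤ) (F : Equiv.Perm (Fin r) → M) :
    shuffleSum m (fun θ => c • F θ) = c • shuffleSum m F :=
  (map_shuffleSum (zsmulAddGroupHom c) m F).symm

theorem val_finRotate_pow (r n : ℕ) (i : Fin (r + 1)) :
    ((finRotate (r + 1) ^ n) i : ℕ) = (i + n) % (r + 1) := by
  induction n with
  | zero => simp [Nat.mod_eq_of_lt i.isLt]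
  | succ n ih => simp [pow_succ', finRotate_apply, Fin.val_add, ih, add_assoc]

theorem val_finRotate_pow_of_lt {m n r : ℕ} (h : m + n = r + 1) (i : Fin (r + 1))
    (hi : (i : ℕ) < m) : ((finRotate (r + 1) ^ n) i : ℕ) = i + n := by
  rw [val_finRotate_pow, Nat.mod_eq_of_lt (by omega)]

theorem val_finRotate_pow_of_le {m n r : ℕ} (h : m + n = r + 1) (i : Fin (r + 1))
    (hi : m ≤ (i : ℕ)) : ((finRotate (r + 1) ^ n) i : ℕ) = i - m := by
  rw [val_finRotate_pow, show (i : ℕ) + n = (i - m) + (r + 1) by omega, Nat.add_mod_right,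
    Nat.mod_eq_of_lt (by omega)]

theorem IsShuffle.mul_finRotate_pow {m n r : ℕ} (h : m + n = r + 1)
    {θ : Equiv.Perm (Fin (r + 1))} (hθ : IsShuffle n θ) :
    IsShuffle m (θ * finRotate (r + 1) ^ n) := by
  intro i j hij hm
  have hij' : (i : ℕ) < j := hij
  refine hθ _ _ (Fin.lt_def.2 ?_) ?_
  all_goals
    rcases hm with hm | hm
    · have h1 := val_finRotate_pow_of_lt h i (by omega)
      have h2 := val_finRotate_pow_of_lt h j (by omega)
      omega
    · have h1 := val_finRotate_pow_of_le h i (by omega)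
      have h2 := val_finRotate_pow_of_le h j (by omega)
      omega

theorem finRotate_pow_mul_pow {m n r : ℕ} (h : m + n = r + 1) :
    finRotate (r + 1) ^ n * finRotate (r + 1) ^ m = 1 := by
  ext i
  rw [← pow_add, val_finRotate_pow, show (i : ℕ) + (n + m) = i + (r + 1) by omega]
  simp [Nat.mod_eq_of_lt i.isLt]

theorem isShuffle_mul_finRotate_pow {m n r : ℕ} (h : m + n = r + 1)
    (θ : Equiv.Perm (Fin (r + 1))) :
    IsShuffle m (θ * finRotate (r + 1) ^ n) ↔ IsShuffle n θ := by
  refine ⟨fun hθ => ?_, IsShuffle.mul_finRotate_pow h⟩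
  have := hθ.mul_finRotate_pow (m := n) (by omega)
  rwa [mul_assoc, finRotate_pow_mul_pow h, mul_one] at this

theorem sign_finRotate_pow {m n r : ℕ} (h : m + n = r + 1) :
    (Equiv.Perm.sign (finRotate (r + 1) ^ n) : ℤ) = (-1) ^ (m * n) := by
  rw [map_pow, sign_finRotate, ← pow_mul, Nat.add_sub_cancel]
  push_cast
  have hr : (r * n + (n + n * n) : ℕ) = m * n + 2 * (n * n) := by
    have : (r + 1) * n = (m + n) * n := by rw [h]
    linarith
  have he : Even (n + n * n) := by
    rw [show n + n * n = n * (n + 1) by ring]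
    exact Nat.even_mul_succ_self n
  have := congrArg (fun e => (-1 : ℤ) ^ e) hr
  simpa [pow_add _ (r * n), pow_add _ (m * n), he.neg_one_pow, pow_mul _ 2] using this

theorem shuffleSum_rotate {m n r : ℕ} (h : m + n = r + 1)
    (F : Equiv.Perm (Fin (r + 1)) → M) :
    shuffleSum m F =
      (-1 : ℤ) ^ (m * n) • shuffleSum n fun θ => F (θ * finRotate (r + 1) ^ n) := by
  simp only [shuffleSum, Finset.smul_sum, smul_ite, smul_zero]
  refine (Fintype.sum_equiv (Equiv.mulRight (finRotate (r + 1) ^ n)) _ _ fun θ => ?_).symm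
  simp only [Equiv.coe_mulRight, isShuffle_mul_finRotate_pow h, map_mul, Units.val_mul,
    sign_finRotate_pow h, smul_smul, mul_comm ((-1 : ℤ) ^ (m * n))]

/-- The extension of a permutation of `Fin r` to `Fin (r + 1)` that fixes the last element. -/
def extendLast {r : ℕ} (σ : Equiv.Perm (Fin r)) : Equiv.Perm (Fin (r + 1)) :=
  finSuccEquivLast.permCongr.symm (Equiv.optionCongr σ)

@[simp] theorem extendLast_last {r : ℕ} (σ : Equiv.Perm (Fin r)) :
    extendLast σ (Fin.last r) = Fin.last r := by
  simp [extendLast, Equiv.permCongr_symm]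

@[simp] theorem extendLast_castSucc {r : ℕ} (σ : Equiv.Perm (Fin r)) (i : Fin r) :
    extendLast σ i.castSucc = (σ i).castSucc := by
  simp [extendLast, Equiv.permCongr_symm]

@[simp] theorem sign_extendLast {r : ℕ} (σ : Equiv.Perm (Fin r)) :
    Equiv.Perm.sign (extendLast σ) = Equiv.Perm.sign σ := by
  rw [extendLast, Equiv.permCongr_symm, Equiv.Perm.sign_permCongr, Equiv.optionCongr_sign]

theorem isShuffle_extendLast {m r : ℕ} (σ : Equiv.Perm (Fin r)) :
    IsShuffle m (extendLast σ) ↔ IsShuffle m σ := by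
  constructor
  · intro h i j hij hp
    simpa using h i.castSucc j.castSucc (by simpa using hij) (by simpa using hp)
  · intro h i j hij hp
    induction i using Fin.lastCases with
    | last => exact absurd hij (Fin.not_lt.2 (Fin.le_last j))
    | cast i =>
      induction j using Fin.lastCases with
      | last => simp [Fin.castSucc_lt_last]
      | cast j => simpa using h i j (by simpa using hij) (by simpa using hp)

theorem sum_shuffle_fix_last {m r : ℕ} (F : Equiv.Perm (Fin (r + 1)) → M) :
    (∑ θ : Equiv.Perm (Fin (r + 1)), if IsShuffle m θ ∧ θ (Fin.last r) = Fin.last r then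
      (Equiv.Perm.sign θ : ℤ) • F θ else 0) = shuffleSum m fun σ => F (extendLast σ) := by
  let e : Option (Fin r) × Equiv.Perm (Fin r) ≃ Equiv.Perm (Fin (r + 1)) :=
    Equiv.Perm.decomposeOption.symm.trans finSuccEquivLast.permCongr.symm
  have hnone (σ : Equiv.Perm (Fin r)) : e (none, σ) = extendLast σ := by
    simp [e, extendLast, Equiv.Perm.decomposeOption, Equiv.Perm.one_def]
  have hsome (i : Fin r) (σ : Equiv.Perm (Fin r)) :
      e (some i, σ) (Fin.last r) ≠ Fin.last r := by
    simp [e, Equiv.permCongr_symm, Fin.castSucc_ne_last]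
  rw [← e.sum_comp, Fintype.sum_prod_type, Fintype.sum_option]
  simp [hnone, hsome, shuffleSum, isShuffle_extendLast]

theorem IsShuffle.apply_ne_last_iff {p q : ℕ} {θ : Equiv.Perm (Fin (p + q + 1 + 1))}
    (hθ : IsShuffle (q + 1) θ) :
    θ ⟨q, by omega⟩ ≠ Fin.last _ ↔ θ (Fin.last _) = Fin.last _ := by
  constructor
  · intro hq
    obtain ⟨j, hj⟩ := θ.surjective (Fin.last _)
    by_cases hl : j = Fin.last _
    · rwa [hl] at hj
    have hlt : j < Fin.last _ := Fin.lt_last_iff_ne_last.2 hl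
    rcases lt_trichotomy (j : ℕ) q with h | h | h
    · exact absurd (hj ▸ hθ j ⟨q, by omega⟩ h (Or.inl (by simp)))
        (Fin.not_lt.2 (Fin.le_last _))
    · exact absurd (by rw [← hj]; congr 1; exact Fin.ext h.symm) hq
    · exact absurd (hj ▸ hθ j (Fin.last _) hlt (Or.inr h)) (Fin.not_lt.2 (Fin.le_last _))
  · intro hl hq
    have := congrArg Fin.val (θ.injective (hq.trans hl.symm))
    simp at this
    omega

theorem shuffleSum_succ (p q : ℕ) (F : Equiv.Perm (Fin (p + q + 1 + 1)) → M) :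
    shuffleSum (p + 1) F = shuffleSum (p + 1) (fun σ => F (extendLast σ)) +
      (-1 : ℤ) ^ ((p + 1) * (q + 1)) •
        shuffleSum (q + 1) fun σ => F (extendLast σ * finRotate (p + q + 1 + 1) ^ (q + 1)) := by
  have hr : (p + 1) + (q + 1) = p + q + 1 + 1 := by ring
  let G (θ : Equiv.Perm (Fin (p + q + 1 + 1))) : M :=
    if θ (Fin.last _) = Fin.last _ then 0 else F θ
  have hsplit : shuffleSum (p + 1) F =
      (∑ θ : Equiv.Perm (Fin (p + q + 1 + 1)),
        if IsShuffle (p + 1) θ ∧ θ (Fin.last _) = Fin.last _ then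
          (Equiv.Perm.sign θ : ℤ) • F θ else 0) + shuffleSum (p + 1) G := by
    simp only [shuffleSum, G, ← Finset.sum_add_distrib]
    refine Finset.sum_congr rfl fun θ _ => ?_
    by_cases h1 : IsShuffle (p + 1) θ <;> by_cases h2 : θ (Fin.last _) = Fin.last _ <;>
      simp [h1, h2]
  rw [hsplit, sum_shuffle_fix_last, shuffleSum_rotate hr G,
    ← sum_shuffle_fix_last
      (fun θ => F (θ * finRotate (p + q + 1 + 1) ^ (q + 1)))]
  congr 2
  refine Finset.sum_congr rfl fun θ _ => ?_
  by_cases h1 : IsShuffle (q + 1) θ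
  · have hrot : (finRotate (p + q + 1 + 1) ^ (q + 1)) (Fin.last _) = ⟨q, by omega⟩ := by
      apply Fin.ext
      rw [val_finRotate_pow_of_le hr _ (by simp)]
      simp
    have h2 := h1.apply_ne_last_iff
    simp only [G, Equiv.Perm.mul_apply, hrot, h1, true_and, if_true]
    by_cases h3 : θ (Fin.last _) = Fin.last _
    · simp [h3, h2.2 h3]
    · simp [h3, not_not.1 (mt h2.1 h3)]
  · simp [h1]

end ShuffleSums

section PolyDerivations

variable {k : Type*} [Field k] {S : Type*} [CommRing S] [Algebra k S]

theorem IsSkewSym.apply_cons {p : ℕ} {P : (Fin (p + 1) → S) → S} (hP : IsSkewSym S (p + 1) P)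
    (y : S) (b : Fin p → S) :
    P (Fin.cons (α := fun _ => S) y b) = (-1 : ℤ) ^ p • P (Fin.snoc (α := fun _ => S) b y) := by
  rw [hP (finRotate (p + 1)), Fin.snoc_eq_cons_rotate, sign_finRotate]
  simp only [Nat.add_sub_cancel, Units.val_pow_eq_pow_val, Units.val_neg, Units.val_one]

theorem IsMultiDer.apply_snoc_mul {p : ℕ} {P : (Fin (p + 1) → S) → S}
    (hP : IsMultiDer S (p + 1) P) (b : Fin p → S) (x y : S) :
    P (Fin.snoc (α := fun _ => S) b (x * y)) =
      x * P (Fin.snoc (α := fun _ => S) b y) + y * P (Fin.snoc (α := fun _ => S) b x) := by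
  simpa [Fin.update_snoc_last] using hP (Fin.snoc (α := fun _ => S) b x) (Fin.last p) x y

/-- `(P∧Q)(a, x)` as a sum over shuffles of the arguments `a`. -/
theorem wedgeProd_snoc (p q : ℕ) (h : p + 1 + (q + 1) = p + q + 2)
    (P : (Fin (p + 1) → S) → S) (Q : (Fin (q + 1) → S) → S) (a : Fin (p + q + 1) → S) (x : S) :
    wedgeProd S (p + 1) (q + 1) (p + q + 2) h P Q (Fin.snoc a x) =
      shuffleSum (p + 1) (fun θ : Equiv.Perm (Fin (p + q + 1)) =>
        P (fun i => a (θ ⟨i, by omega⟩)) *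
          Q (Fin.snoc (α := fun _ => S) (fun j => a (θ ⟨p + 1 + j, by omega⟩)) x)) +
      (-1 : ℤ) ^ ((p + 1) * (q + 1)) •
        shuffleSum (q + 1) (fun θ : Equiv.Perm (Fin (p + q + 1)) =>
          P (Fin.snoc (α := fun _ => S) (fun i => a (θ ⟨q + 1 + i, by omega⟩)) x) *
            Q (fun j => a (θ ⟨j, by omega⟩))) := by
  have hr : (p + 1) + (q + 1) = p + q + 1 + 1 := by ring
  have hc (σ : Equiv.Perm (Fin (p + q + 1))) (i : ℕ) (hi : i < p + q + 1) :
      extendLast σ ⟨i, by omega⟩ = (σ ⟨i, hi⟩).castSucc := extendLast_castSucc σ ⟨i, hi⟩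
  have hl (σ : Equiv.Perm (Fin (p + q + 1))) :
      extendLast σ ⟨p + q + 1, Nat.lt_succ_self _⟩ = Fin.last _ := extendLast_last σ
  refine (shuffleSum_succ p q _).trans ?_
  congr 2
  · funext σ
    congr 2
    · funext i
      rw [hc σ i (by omega), Fin.snoc_castSucc]
    · funext j
      induction j using Fin.lastCases with
      | last =>
        rw [Fin.snoc_last]
        have : (⟨p + 1 + (Fin.last q : Fin (q + 1)), by simp; omega⟩ : Fin (p + q + 1 + 1)) =
          ⟨p + q + 1, by omega⟩ := Fin.ext (by simp; omega)
        rw [this, hl, Fin.snoc_last]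
      | cast j =>
        rw [Fin.snoc_castSucc]
        exact (congrArg _ (hc σ (p + 1 + j) (by omega))).trans (Fin.snoc_castSucc ..)
  · congr 1
    funext σ
    congr 2
    · funext i
      have hi : (finRotate (p + q + 1 + 1) ^ (q + 1)) ⟨i, by omega⟩ = ⟨q + 1 + i, by omega⟩ :=
        Fin.ext ((val_finRotate_pow_of_lt hr _ i.isLt).trans (Nat.add_comm _ _))
      rw [Equiv.Perm.mul_apply, hi]
      induction i using Fin.lastCases with
      | last =>
        rw [Fin.snoc_last]
        have : (⟨q + 1 + (Fin.last p : Fin (p + 1)), by simp; omega⟩ : Fin (p + q + 1 + 1)) =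
          ⟨p + q + 1, by omega⟩ := Fin.ext (by simp; omega)
        rw [this, hl, Fin.snoc_last]
      | cast i =>
        rw [Fin.snoc_castSucc]
        exact (congrArg _ (hc σ (q + 1 + i) (by omega))).trans (Fin.snoc_castSucc ..)
    · funext j
      have hj : (finRotate (p + q + 1 + 1) ^ (q + 1)) ⟨p + 1 + j, by omega⟩ = ⟨j, by omega⟩ :=
        Fin.ext ((val_finRotate_pow_of_le hr _ (by simp)).trans (by simp))
      rw [Equiv.Perm.mul_apply, hj, hc σ j (by omega), Fin.snoc_castSucc]

/-- `P∧Q` as a sum over the shuffles that select the arguments of `Q` first. -/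
theorem wedgeProd_eq_shuffleSum_swap {m n r : ℕ} (h : m + n = r + 1)
    (P : (Fin m → S) → S) (Q : (Fin n → S) → S) (a : Fin (r + 1) → S) :
    wedgeProd S m n (r + 1) h P Q a =
      (-1 : ℤ) ^ (m * n) • shuffleSum n (fun θ : Equiv.Perm (Fin (r + 1)) =>
        P (fun i => a (θ ⟨n + i, by omega⟩)) * Q (fun j => a (θ ⟨j, by omega⟩))) := by
  refine (shuffleSum_rotate h _).trans ?_
  congr 2
  funext θ
  congr 2
  · funext i
    exact congrArg (fun l => a (θ l))
      (Fin.ext ((val_finRotate_pow_of_lt h _ i.isLt).trans (Nat.add_comm _ _)))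
  · funext j
    exact congrArg (fun l => a (θ l))
      (Fin.ext ((val_finRotate_pow_of_le h _ (by simp)).trans (by simp)))

theorem circProd_eq_shuffleSum {p n r : ℕ} (h : p + n = r) (h' : p + 1 + n = r + 1)
    (hp : 1 ≤ p + 1) {P : (Fin (p + 1) → S) → S}
    (hP : IsSkewSym S (p + 1) P) (Q : (Fin n → S) → S) (a : Fin r → S) :
    circProd S (p + 1) n r h' hp P Q a =
      (-1 : ℤ) ^ p • shuffleSum n (fun θ : Equiv.Perm (Fin r) =>
        P (Fin.snoc (α := fun _ => S) (fun i => a (θ ⟨n + i, by omega⟩))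
          (Q fun j => a (θ ⟨j, by omega⟩)))) := by
  rw [← shuffleSum_zsmul]
  unfold circProd shuffleSum
  refine Finset.sum_congr rfl fun θ _ => ?_
  congr 2
  change _ = (-1 : ℤ) ^ p • P _
  rw [← hP.apply_cons]
  congr 1
  funext l
  refine Fin.cases ?_ (fun l => ?_) l <;> simp

theorem form_shuffleSum_mul (B : S →ₗ[k] S →ₗ[k] k)
    (hBassoc : ∀ a b c : S, B (a * b) c = B a (b * c)) {p : ℕ} {P : (Fin (p + 1) → S) → S}
    (hP : IsMultiDer S (p + 1) P) {DP : (Fin p → S) → S}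
    (hDP : ∀ (a : Fin p → S) (x : S),
      B (DP a) x = (-1 : ℤ) ^ p • B (P (Fin.snoc a x)) 1)
    {r : ℕ} (n : ℕ) (b : Equiv.Perm (Fin r) → Fin p → S) (c : Equiv.Perm (Fin r) → S) (x : S) :
    B (shuffleSum n fun θ => DP (b θ) * c θ) x = (-1 : ℤ) ^ p •
      (B (shuffleSum n fun θ => P (Fin.snoc (α := fun _ => S) (b θ) x) * c θ) 1 +
        B (shuffleSum n fun θ => P (Fin.snoc (α := fun _ => S) (b θ) (c θ))) x) := by
  have hmap (F : Equiv.Perm (Fin r) → S) (y : S) :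
      B (shuffleSum n F) y = shuffleSum n fun θ => B (F θ) y :=
    map_shuffleSum (B.flip y).toAddMonoidHom n F
  rw [hmap, hmap, hmap, ← shuffleSum_add, ← shuffleSum_zsmul]
  congr 1
  funext θ
  rw [hBassoc, hDP, hP.apply_snoc_mul, map_add, LinearMap.add_apply, mul_comm (c θ),
    mul_comm x, hBassoc _ x, mul_one]

end PolyDerivations

/-- the BV relation on polyderivations:
`[P, Q]_S = −(−1)^{(m−1)n} (Δ(P∧Q) − Δ(P)∧Q − (−1)^m P∧Δ(Q))`,
with `m = p+1`, `n = q+1`, and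
`[P,Q]_S = P∘Q − (−1)^{(m−1)(n−1)} Q∘P` the Schouten bracket. -/
theorem bv_relation_on_polyderivations
    (k : Type*) [Field k] (S : Type*) [CommRing S] [Algebra k S]
    [FiniteDimensional k S]
    -- the Poisson bracket on S, k-bilinear
    (br : S →ₗ[k] S →ₗ[k] S)
    (hanti : ∀ a b : S, br a b = - br b a)
    (hjacobi : ∀ a b c : S, br a (br b c) + br b (br c a) + br c (br a b) = 0)
    (hleib : ∀ a b c : S, br a (b * c) = br a b * c + br a c * b)
    -- the Frobenius bilinear form ⟨-,-⟩, nondegenerate, associative, symmetric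
    (B : S →ₗ[k] S →ₗ[k] k)
    (hBnd : ∀ a : S, (∀ b : S, B a b = 0) → a = 0)
    (hBassoc : ∀ a b c : S, B (a * b) c = B a (b * c))
    (hBsymm : ∀ a b : S, B a b = B b a)
    -- P ∈ 𝔛^{p+1}(S), Q ∈ 𝔛^{q+1}(S)
    (p q : ℕ)
    (P : (Fin (p+1) → S) → S) (hP : IsPolyDer k S (p+1) P)
    (Q : (Fin (q+1) → S) → S) (hQ : IsPolyDer k S (q+1) Q)
    -- DP = Δ(P)
    (DP : (Fin p → S) → S)
    (hDP : ∀ (a : Fin p → S) (x : S),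
      B (DP a) x = (-1 : ℤ)^p • B (P (Fin.snoc a x)) 1)
    -- DQ = Δ(Q)
    (DQ : (Fin q → S) → S)
    (hDQ : ∀ (a : Fin q → S) (x : S),
      B (DQ a) x = (-1 : ℤ)^q • B (Q (Fin.snoc a x)) 1)
    -- DPQ = Δ(P ∧ Q)
    (DPQ : (Fin (p+q+1) → S) → S)
    (hDPQ : ∀ (a : Fin (p+q+1) → S) (x : S),
      B (DPQ a) x = (-1 : ℤ)^(p+q+1) •
        B (wedgeProd S (p+1) (q+1) (p+q+2) (by omega) P Q (Fin.snoc a x)) 1) :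
    ∀ a : Fin (p+q+1) → S,
      circProd S (p+1) (q+1) (p+q+1) (by omega) (by omega) P Q a
        - (-1 : ℤ)^(p*q) • circProd S (q+1) (p+1) (p+q+1) (by omega) (by omega) Q P a
      = -((-1 : ℤ)^(p*(q+1)) •
          (DPQ a - wedgeProd S p (q+1) (p+q+1) (by omega) DP Q a
            - (-1 : ℤ)^(p+1) • wedgeProd S (p+1) q (p+q+1) (by omega) P DQ a)) := by
  intro a
  rw [← sub_eq_zero]
  refine hBnd _ fun x => ?_
  have hr : p + (q + 1) = p + q + 1 := by omega
  have hr' : q + (p + 1) = p + q + 1 := by omega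
  rw [circProd_eq_shuffleSum hr _ _ hP.2.1, circProd_eq_shuffleSum hr' _ _ hQ.2.1,
    wedgeProd_eq_shuffleSum_swap hr]
  have hfst := form_shuffleSum_mul B hBassoc hP.2.2 hDP (q + 1)
    (fun (θ : Equiv.Perm (Fin (p + q + 1))) i => a (θ ⟨q + 1 + i, by omega⟩))
    (fun θ => Q fun j => a (θ ⟨j, by omega⟩)) x
  have hsnd := form_shuffleSum_mul B hBassoc hQ.2.2 hDQ (p + 1)
    (fun (θ : Equiv.Perm (Fin (p + q + 1))) j => a (θ ⟨p + 1 + j, by omega⟩))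
    (fun θ => P fun i => a (θ ⟨i, by omega⟩)) x
  have hwedge : wedgeProd S (p + 1) q (p + q + 1) (by omega) P DQ a =
      shuffleSum (p + 1) fun θ : Equiv.Perm (Fin (p + q + 1)) =>
        DQ (fun j => a (θ ⟨p + 1 + j, by omega⟩)) * P fun i => a (θ ⟨i, by omega⟩) := by
    simp only [mul_comm (DQ _)]
    rfl
  have hD := hDPQ a x
  rw [wedgeProd_snoc] at hD
  simp only [mul_comm (Q (Fin.snoc _ x))] at hsnd
  rw [hwedge]
  simp only [map_sub, map_neg, map_zsmul, map_add, LinearMap.sub_apply, LinearMap.neg_apply,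
    LinearMap.smul_apply, LinearMap.add_apply, hfst, hsnd, hD]
  rcases Nat.even_or_odd p with hp | hp <;> rcases Nat.even_or_odd q with hq | hq <;>
    simp only [pow_add, pow_mul, pow_one, hp.neg_one_pow, hq.neg_one_pow, one_pow] <;>
    simp [hq.neg_one_pow] <;> abel
end

section
/- Let m ≥ 1 and n ≥ 0 be integers. Regard each θ ∈ S_{m−1,n} (a permutation of {1,…,m+n−1}) as a permutation of {1,…,m+n} fixing m+n. Let c be the cyclic permutation (m+n, m+n−1, …, m+1, m), i.e. c sends m+n ↦ m+n−1, m+n−1 ↦ m+n−2, …, m+1 ↦ m, and m ↦ m+n, fixing all other points. Then the map θ ↦ θ∘c is a well-defined bijection from S_{m−1,n} onto the set {τ ∈ S_{m,n} : τ(m) = m+n}, and ε(θ∘c) = (−1)^n ε(θ) for every θ ∈ S_{m−1,n}. -/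
/-- A permutation `θ` of `{0, …, r−1}` regarded as a permutation of
`{0, …, r}` fixing the last point `r`. -/
def extPerm {r : ℕ} (θ : Equiv.Perm (Fin r)) : Equiv.Perm (Fin (r+1)) :=
  finSumFinEquiv.permCongr (Equiv.sumCongr θ (Equiv.refl (Fin 1)))

/-- The cyclic permutation `(p+n, p+n−1, …, p)` (0-based) of `{0, …, p+n}`:
it sends `p+n ↦ p+n−1`, `p+n−1 ↦ p+n−2`, …, `p+1 ↦ p`, and `p ↦ p+n`,
fixing all points `< p`.  (In the 1-based indexing of the paper, with
`m = p+1`, this is the cycle `(m+n, m+n−1, …, m)`.) -/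
def cycPerm (p n : ℕ) : Equiv.Perm (Fin (p+n+1)) :=
  (finSumFinEquiv (m := p) (n := n+1)).permCongr
    (Equiv.sumCongr (Equiv.refl (Fin p)) (finRotate (n+1)).symm)

theorem lt_add_add_one (p n : ℕ) : p < p + n + 1 :=
  Nat.lt_succ_of_le (Nat.le_add_right p n)

theorem extPerm_castSucc {r : ℕ} (θ : Equiv.Perm (Fin r)) (i : Fin r) :
    extPerm θ i.castSucc = (θ i).castSucc := by
  have h : finSumFinEquiv.symm i.castSucc = (Sum.inl i : Fin r ⊕ Fin 1) := by
    rw [Equiv.symm_apply_eq]; rfl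
  simp only [extPerm, Equiv.permCongr_apply, h]
  rfl

theorem extPerm_last {r : ℕ} (θ : Equiv.Perm (Fin r)) :
    extPerm θ (Fin.last r) = Fin.last r := by
  have h : finSumFinEquiv.symm (Fin.last r) = (Sum.inr 0 : Fin r ⊕ Fin 1) := by
    rw [Equiv.symm_apply_eq]; rfl
  simp only [extPerm, Equiv.permCongr_apply, h]
  rfl

theorem sign_extPerm {r : ℕ} (θ : Equiv.Perm (Fin r)) :
    Equiv.Perm.sign (extPerm θ) = Equiv.Perm.sign θ := by
  simp [extPerm, Equiv.Perm.sign_permCongr, Equiv.Perm.sign_sumCongr]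

theorem extPerm_injective {r : ℕ} : Function.Injective (extPerm (r := r)) := by
  intro θ θ' h
  ext i
  have hi := congrArg (fun σ => σ i.castSucc) h
  simp only [extPerm_castSucc, Fin.castSucc_inj] at hi
  rw [hi]

theorem exists_extPerm_eq {r : ℕ} (σ : Equiv.Perm (Fin (r + 1)))
    (hσ : σ (Fin.last r) = Fin.last r) : ∃ θ, extPerm θ = σ := by
  have hne (i : Fin r) : σ i.castSucc ≠ Fin.last r := fun h =>
    Fin.castSucc_ne_last i (σ.injective (h.trans hσ.symm))
  let f : Fin r → Fin r := fun i => (σ i.castSucc).castPred (hne i)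
  have hf : Function.Injective f := by
    intro i j hij
    simpa [f] using hij
  refine ⟨Equiv.ofBijective f (Finite.injective_iff_bijective.mp hf), Equiv.ext fun i => ?_⟩
  induction i using Fin.lastCases with
  | last => rw [extPerm_last, hσ]
  | cast i => simp [extPerm_castSucc, f]

theorem cycPerm_pivot (p n : ℕ) :
    cycPerm p n ⟨p, lt_add_add_one p n⟩ = Fin.last (p + n) := by
  have h : finSumFinEquiv.symm (⟨p, lt_add_add_one p n⟩ : Fin (p + (n + 1)))
      = (Sum.inr 0 : Fin p ⊕ Fin (n + 1)) := by
    rw [Equiv.symm_apply_eq]; rfl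
  have h' : (finRotate (n + 1)).symm 0 = Fin.last n := by
    rw [Equiv.symm_apply_eq, finRotate_last]
  exact (congrArg _ (congrArg _ h)).trans (congrArg (Fin.natAdd p) h')

theorem cycPerm_succAbove (p n : ℕ) (i : Fin (p + n)) :
    cycPerm p n ((⟨p, lt_add_add_one p n⟩ : Fin (p + n + 1)).succAbove i) = i.castSucc := by
  induction i using Fin.addCases with
  | left i =>
    have h : (finSumFinEquiv (m := p) (n := n + 1)).symm
        ((⟨p, lt_add_add_one p n⟩ : Fin (p + n + 1)).succAbove (Fin.castAdd n i))
        = (Sum.inl i : Fin p ⊕ Fin (n + 1)) := by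
      rw [Equiv.symm_apply_eq, Fin.succAbove_of_castSucc_lt _ _ (by simp [Fin.lt_def])]
      rfl
    exact (congrArg _ (congrArg _ h)).trans rfl
  | right i =>
    have h : (finSumFinEquiv (m := p) (n := n + 1)).symm
        ((⟨p, lt_add_add_one p n⟩ : Fin (p + n + 1)).succAbove (Fin.natAdd p i))
        = (Sum.inr i.succ : Fin p ⊕ Fin (n + 1)) := by
      rw [Equiv.symm_apply_eq, Fin.succAbove_of_le_castSucc _ _ (by simp [Fin.le_def])]
      rfl
    have h' : (finRotate (n + 1)).symm i.succ = i.castSucc := by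
      rw [Equiv.symm_apply_eq, finRotate_apply, Fin.coeSucc_eq_succ]
    exact (congrArg _ (congrArg _ h)).trans (congrArg (Fin.natAdd p) h')

theorem sign_cycPerm (p n : ℕ) : Equiv.Perm.sign (cycPerm p n) = (-1) ^ n := by
  refine (Equiv.Perm.sign_permCongr _ _).trans ?_
  rw [Equiv.Perm.sign_sumCongr, Equiv.Perm.sign_symm, sign_finRotate]
  simp

theorem extPerm_mul_cycPerm_pivot {p n : ℕ} (θ : Equiv.Perm (Fin (p + n))) :
    (extPerm θ * cycPerm p n) ⟨p, lt_add_add_one p n⟩ = Fin.last (p + n) := by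
  rw [Equiv.Perm.mul_apply, cycPerm_pivot, extPerm_last]

theorem extPerm_mul_cycPerm_succAbove {p n : ℕ} (θ : Equiv.Perm (Fin (p + n)))
    (i : Fin (p + n)) :
    (extPerm θ * cycPerm p n) ((⟨p, lt_add_add_one p n⟩ : Fin (p + n + 1)).succAbove i)
      = (θ i).castSucc := by
  rw [Equiv.Perm.mul_apply, cycPerm_succAbove, extPerm_castSucc]

theorem val_pivot_succAbove {p n : ℕ} (i : Fin (p + n)) :
    (((⟨p, lt_add_add_one p n⟩ : Fin (p + n + 1)).succAbove i : Fin (p + n + 1)) : ℕ)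
      = if (i : ℕ) < p then (i : ℕ) else i + 1 := by
  simp only [Fin.succAbove, Fin.lt_def]
  split_ifs <;> simp_all

theorem isShuffle_extPerm_mul_cycPerm_iff {p n : ℕ} (θ : Equiv.Perm (Fin (p + n))) :
    IsShuffle (p + 1) (extPerm θ * cycPerm p n) ↔ IsShuffle p θ := by
  constructor
  · intro h i j hij hp
    have hτ := h _ _ (Fin.strictMono_succAbove ⟨p, lt_add_add_one p n⟩ hij) (by
      rw [val_pivot_succAbove, val_pivot_succAbove]
      split_ifs <;> omega)
    simpa only [extPerm_mul_cycPerm_succAbove, Fin.castSucc_lt_castSucc_iff] using hτ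
  · intro h i j hij hp
    rcases Fin.eq_self_or_eq_succAbove ⟨p, lt_add_add_one p n⟩ i with hi | ⟨i, rfl⟩
    · simp only [hi, Fin.lt_def] at hij hp
      omega
    rcases Fin.eq_self_or_eq_succAbove ⟨p, lt_add_add_one p n⟩ j with hj | ⟨j, rfl⟩
    · rw [hj, extPerm_mul_cycPerm_pivot, extPerm_mul_cycPerm_succAbove]
      exact Fin.castSucc_lt_last _
    · rw [val_pivot_succAbove, val_pivot_succAbove] at hp
      rw [extPerm_mul_cycPerm_succAbove, extPerm_mul_cycPerm_succAbove,
        Fin.castSucc_lt_castSucc_iff]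
      refine h i j ((Fin.strictMono_succAbove _).lt_iff_lt.mp hij) ?_
      split_ifs at hp <;> omega

/-- `θ ↦ θ∘c` is a bijection from the set of
`(m−1, n)`-shuffles onto the set `{τ ∈ S_{m,n} : τ(m) = m+n}`, and
`ε(θ∘c) = (−1)^n ε(θ)`.  Here `m = p+1 ≥ 1`, `n ≥ 0`; permutations are
0-based, so `τ(m) = m+n` reads `τ(p) = p+n`. -/
theorem shuffle_cycle_bijection (p n : ℕ) :
    Set.BijOn (fun θ : Equiv.Perm (Fin (p+n)) => extPerm θ * cycPerm p n)
      {θ : Equiv.Perm (Fin (p+n)) | IsShuffle p θ}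
      {τ : Equiv.Perm (Fin (p+n+1)) |
        IsShuffle (p+1) τ ∧ τ ⟨p, by omega⟩ = ⟨p+n, by omega⟩} ∧
    ∀ θ : Equiv.Perm (Fin (p+n)), IsShuffle p θ →
      (Equiv.Perm.sign (extPerm θ * cycPerm p n) : ℤ)
        = (-1 : ℤ)^n * (Equiv.Perm.sign θ : ℤ) := by
  refine ⟨⟨fun θ hθ => ⟨(isShuffle_extPerm_mul_cycPerm_iff θ).mpr hθ,
    extPerm_mul_cycPerm_pivot θ⟩, ?_, ?_⟩, fun θ _ => ?_⟩
  · exact fun θ _ θ' _ h => extPerm_injective (mul_right_cancel h)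
  · rintro τ ⟨hτ, hp⟩
    obtain ⟨θ, hθ⟩ := exists_extPerm_eq (τ * (cycPerm p n)⁻¹) (by
      rw [← cycPerm_pivot, Equiv.Perm.mul_apply, Equiv.Perm.inv_def, Equiv.symm_apply_apply,
        hp, cycPerm_pivot]
      rfl)
    have hmul : extPerm θ * cycPerm p n = τ := by rw [hθ, inv_mul_cancel_right]
    exact ⟨θ, (isShuffle_extPerm_mul_cycPerm_iff θ).mp (hmul ▸ hτ), hmul⟩
  · rw [Equiv.Perm.sign_mul, sign_extPerm, sign_cycPerm, mul_comm]
    simp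
end

section
/- Let S be a Frobenius Poisson algebra over a field k with nondegenerate associative symmetric bilinear form ⟨-,-⟩. The following are equivalent: (1) ⟨{x, y}, 1⟩ = 0 for all x, y ∈ S (S is unimodular); (2) ⟨{a, b}, c⟩ = ⟨b, {c, a}⟩ for all a, b, c ∈ S; (3) the Frobenius isomorphism σ : S → S*, σ(b)(a) := ⟨a, b⟩, is a morphism of right Poisson modules, i.e. σ({x, y}) = {σ(x), y}_{S*} for all x, y ∈ S, where S* carries the right Poisson module structure dual to the left Poisson module S, {α, y}_{S*}(z) := α({y, z}). -/
/-- characterizations of unimodularity for a Frobenius Poisson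
algebra: (1) `⟨{x,y}, 1⟩ = 0`; (2) `⟨{a,b}, c⟩ = ⟨b, {c,a}⟩`; (3) the Frobenius
isomorphism `σ : S → S*`, `σ(b)(a) = ⟨a,b⟩`, is a morphism of right Poisson
modules, i.e. `σ({x,y}) = {σ(x), y}_{S*}` where `{α, y}_{S*}(z) = α({y,z})`. -/
theorem unimodular_tfae
    (k : Type*) [Field k] (S : Type*) [CommRing S] [Algebra k S]
    [FiniteDimensional k S]
    -- the Poisson bracket on S, k-bilinear
    (br : S →ₗ[k] S →ₗ[k] S)
    (hanti : ∀ a b : S, br a b = - br b a)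
    (hjacobi : ∀ a b c : S, br a (br b c) + br b (br c a) + br c (br a b) = 0)
    (hleib : ∀ a b c : S, br a (b * c) = br a b * c + br a c * b)
    -- the Frobenius bilinear form ⟨-,-⟩, nondegenerate, associative, symmetric
    (B : S →ₗ[k] S →ₗ[k] k)
    (hBnd : ∀ a : S, (∀ b : S, B a b = 0) → a = 0)
    (hBassoc : ∀ a b c : S, B (a * b) c = B a (b * c))
    (hBsymm : ∀ a b : S, B a b = B b a) :
    -- (1) ↔ (2)
    ((∀ x y : S, B (br x y) 1 = 0) ↔
      (∀ a b c : S, B (br a b) c = B b (br c a))) ∧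
    -- (1) ↔ (3):  σ(b) = B.flip b  and  {σ(x), y}_{S*} = σ(x) ∘ {y, -}
    ((∀ x y : S, B (br x y) 1 = 0) ↔
      (∀ x y : S, B.flip (br x y) = (B.flip x).comp (br y))) := by
  have br_one : ∀ a, br a 1 = 0 := fun a => by
    simpa using hleib a 1 1
  have mul_one_form : ∀ a b, B (a * b) 1 = B a b := fun a b => by
    rw [hBassoc, mul_one]
  have invariant_iff : (∀ x y : S, B (br x y) 1 = 0) ↔
      (∀ a b c : S, B (br a b) c = B b (br c a)) := by
    refine ⟨fun h a b c => ?_, fun h x y => ?_⟩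
    · have key := h a (b * c)
      rw [hleib, map_add, LinearMap.add_apply, mul_one_form, mul_one_form] at key
      rw [hBsymm b, hanti c a, map_neg, LinearMap.neg_apply]
      exact eq_neg_of_add_eq_zero_left key
    · rw [h, hanti, br_one, neg_zero, map_zero]
  refine ⟨invariant_iff, invariant_iff.trans ⟨fun h x y => ?_, fun h a b c => ?_⟩⟩
  · ext z
    exact (h y z x).symm
  · exact (LinearMap.congr_fun (h c a) b).symm
end

section
/- Let S be a unimodular Frobenius Poisson algebra over a field k, i.e. a Frobenius Poisson algebra with nondegenerate associative symmetric bilinear form ⟨-,-⟩ satisfying ⟨{x, y}, 1⟩ = 0 for all x, y ∈ S. Let m ≥ 1 and P ∈ 𝔛^m(S). Suppose DP : S^{m−1} → S satisfies ⟨DP(a_1,…,a_{m−1}), a_m⟩ = (−1)^{m−1} ⟨P(a_1,…,a_m), 1⟩ for all a_i ∈ S, and E : S^m → S satisfies ⟨E(a_0,…,a_{m−1}), x⟩ = (−1)^m ⟨δ_m(P)(a_0,…,a_{m−1}, x), 1⟩ for all a_0,…,a_{m−1}, x ∈ S. Then E = −δ_{m−1}(DP); that is, the operator Δ anticommutes with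 the Poisson coboundary δ, so Δ descends to an operator on Poisson cohomology. -/
theorem IsSkewSym.map_cons {S : Type*} [CommRing S] {p : ℕ} {P : (Fin (p+1) → S) → S}
    (hP : IsSkewSym S (p+1) P) (b : Fin p → S) (c : S) :
    P (Fin.cons c b : Fin (p+1) → S) = (-1 : ℤ)^p • P (Fin.snoc b c) := by
  rw [hP (finRotate (p+1)) (Fin.cons c b : Fin (p+1) → S), sign_finRotate]
  have h : (Fin.snoc b c : Fin (p+1) → S)
      = fun i => (Fin.cons c b : Fin (p+1) → S) (finRotate (p+1) i) :=
    Fin.snoc_eq_cons_rotate b c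
  rw [h]
  simp

/-- Integration by parts for a bracket whose values have zero integral. -/
theorem pairing_bracket_left {k S : Type*} [Field k] [CommRing S] [Algebra k S]
    (br : S →ₗ[k] S →ₗ[k] S)
    (hleib : ∀ a b c : S, br a (b * c) = br a b * c + br a c * b)
    (B : S →ₗ[k] S →ₗ[k] k)
    (hBassoc : ∀ a b c : S, B (a * b) c = B a (b * c))
    (huni : ∀ x y : S, B (br x y) 1 = 0) (a b c : S) :
    B (br a b) c = - B b (br a c) := by
  have h := huni a (b * c)
  rw [hleib, map_add, LinearMap.add_apply, mul_comm (br a c) b, hBassoc, hBassoc, mul_one,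
    mul_one] at h
  exact eq_neg_of_add_eq_zero_left h

/-- The arguments of the bracket term of `δ(P)(a, x)` indexed by `i < j ≤ p`. -/
theorem skipTwo_args_castSucc {S : Type*} {p : ℕ} (a : Fin (p+1) → S) (x c : S)
    (i j : Fin (p+1)) (hij : i < j) :
    (fun l : Fin (p+1) => if _h0 : (l : ℕ) = 0 then c
      else (Fin.snoc a x : Fin (p+2) → S)
        ⟨skipTwo i.castSucc.val j.castSucc.val (l.val - 1), by
          have h1 := l.isLt
          simp only [skipTwo]; split_ifs <;> omega⟩)
    = (Fin.snoc (fun l : Fin p => if _h0 : (l : ℕ) = 0 then c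
        else a ⟨skipTwo i.val j.val (l.val - 1), by
          have h1 := l.isLt
          simp only [skipTwo]; split_ifs <;> omega⟩) x : Fin (p+1) → S) := by
  have hj := j.isLt
  have hij' : i.val < j.val := hij
  funext l
  refine Fin.lastCases ?_ (fun l => ?_) l
  · have hp : p ≠ 0 := by omega
    have hs : skipTwo i.val j.val (p - 1) = p + 1 := by
      simp only [skipTwo]; split_ifs <;> omega
    simp [hp, hs, Fin.snoc]
  · have hl := l.isLt
    by_cases h0 : (l : ℕ) = 0
    · simp [h0]
    · have hs : skipTwo i.val j.val (l.val - 1) < p + 1 := by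
        simp only [skipTwo]; split_ifs <;> omega
      simp [h0, hs, Fin.snoc]

/-- The arguments of the bracket term of `δ(P)(a, x)` indexed by `i ≤ p` and the last index. -/
theorem skipTwo_args_last {S : Type*} {p : ℕ} (a : Fin (p+1) → S) (x c : S) (i : Fin (p+1)) :
    (fun l : Fin (p+1) => if _h0 : (l : ℕ) = 0 then c
      else (Fin.snoc a x : Fin (p+2) → S)
        ⟨skipTwo i.castSucc.val (Fin.last (p+1)).val (l.val - 1), by
          have h1 := l.isLt
          simp only [skipTwo]; split_ifs <;> omega⟩)
    = (Fin.cons c (fun l => a (i.succAbove l)) : Fin (p+1) → S) := by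
  funext l
  refine Fin.cases ?_ (fun l => ?_) l
  · simp
  · have hl := l.isLt
    have hs : skipTwo i.val (p + 1) l.val = (i.succAbove l).val := by
      simp only [skipTwo, Fin.succAbove, Fin.lt_def, Fin.val_castSucc]
      split_ifs <;> simp <;> omega
    have hlt : ¬ p < (i.succAbove l).val := not_lt.2 (Nat.le_of_lt_succ (i.succAbove l).isLt)
    simp [hs, Fin.snoc, hlt]

/-- on a unimodular Frobenius Poisson algebra the BV operator `Δ`
anticommutes with the Poisson coboundary `δ`:  if `P ∈ 𝔛^m(S)` (`m = p+1`),
`DP = Δ(P)` and `E = Δ(δ_m(P))` (both characterized by their pairings), then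
`E = −δ_{m−1}(DP)`. -/
theorem bv_operator_anticommutes_with_coboundary
    (k : Type*) [Field k] (S : Type*) [CommRing S] [Algebra k S]
    [FiniteDimensional k S]
    -- the Poisson bracket on S, k-bilinear
    (br : S →ₗ[k] S →ₗ[k] S)
    (hanti : ∀ a b : S, br a b = - br b a)
    (hjacobi : ∀ a b c : S, br a (br b c) + br b (br c a) + br c (br a b) = 0)
    (hleib : ∀ a b c : S, br a (b * c) = br a b * c + br a c * b)
    -- the Frobenius bilinear form ⟨-,-⟩, nondegenerate, associative, symmetric
    (B : S →ₗ[k] S →ₗ[k] k)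
    (hBnd : ∀ a : S, (∀ b : S, B a b = 0) → a = 0)
    (hBassoc : ∀ a b c : S, B (a * b) c = B a (b * c))
    (hBsymm : ∀ a b : S, B a b = B b a)
    -- S is unimodular
    (huni : ∀ x y : S, B (br x y) 1 = 0)
    -- P ∈ 𝔛^{p+1}(S)
    (p : ℕ) (P : (Fin (p+1) → S) → S) (hP : IsPolyDer k S (p+1) P)
    -- DP = Δ(P):  ⟨DP(a_1,…,a_m-1), a_m⟩ = (−1)^{m−1} ⟨P(a_1,…,a_m), 1⟩
    (DP : (Fin p → S) → S)
    (hDP : ∀ (a : Fin p → S) (x : S),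
      B (DP a) x = (-1 : ℤ)^p • B (P (Fin.snoc a x)) 1)
    -- E = Δ(δ_m(P)):  ⟨E(a_0,…,a_{m−1}), x⟩ = (−1)^m ⟨δ_m(P)(a_0,…,a_{m−1},x), 1⟩
    (E : (Fin (p+1) → S) → S)
    (hE : ∀ (a : Fin (p+1) → S) (x : S),
      B (E a) x = (-1 : ℤ)^(p+1) • B (pDelta k S br (p+1) P (Fin.snoc a x)) 1) :
    E = - pDelta k S br p DP := by
  funext a
  rw [Pi.neg_apply, ← sub_eq_zero, sub_neg_eq_add]
  refine hBnd _ fun x => ?_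
  have hcoboundary : B (pDelta k S br (p+1) P (Fin.snoc a x)) 1
      = (-1 : ℤ)^p • B (pDelta k S br p DP a) x := by
    have hbracket : ∀ i : Fin (p+1),
        B (P (Fin.cons (br (a i) x) (fun l => a (i.succAbove l)) : Fin (p+1) → S)) 1
          = - B (br (a i) (DP fun l => a (i.succAbove l))) x := by
      intro i
      rw [hP.2.1.map_cons, pairing_bracket_left br hleib B hBassoc huni, neg_neg, hDP,
        map_zsmul, LinearMap.smul_apply]
    have hpair : ∀ b : Fin p → S, B (P (Fin.snoc b x)) 1 = (-1 : ℤ)^p • B (DP b) x := by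
      intro b
      rw [hDP, smul_smul, ← mul_pow]
      simp
    simp only [pDelta, map_add, map_sum, map_zsmul, LinearMap.add_apply, LinearMap.sum_apply,
      LinearMap.smul_apply, huni, smul_zero, Finset.sum_const_zero, zero_add]
    rw [Fin.sum_univ_castSucc]
    have hlast : ∀ j : Fin (p+2), ¬ Fin.last (p+1) < j := fun j => not_lt.2 (Fin.le_last j)
    simp only [hlast, if_false, map_zero, LinearMap.zero_apply, Finset.sum_const_zero, add_zero]
    simp only [Fin.sum_univ_castSucc (n := p+1), Fin.castSucc_lt_last, if_true,
      Fin.castSucc_lt_castSucc_iff, Fin.snoc_castSucc, Fin.snoc_last]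
    rw [Finset.sum_add_distrib, add_comm, smul_add, Finset.smul_sum, Finset.smul_sum]
    congr 1
    · refine Finset.sum_congr rfl fun i _ => ?_
      rw [skipTwo_args_last, map_zsmul, LinearMap.smul_apply, hbracket, smul_smul, smul_neg, ← neg_smul]
      congr 1
      simp
      ring
    · refine Finset.sum_congr rfl fun i _ => ?_
      rw [Finset.smul_sum]
      refine Finset.sum_congr rfl fun j _ => ?_
      by_cases hij : i < j
      · rw [if_pos hij, if_pos hij, skipTwo_args_castSucc a x _ i j hij, map_zsmul, map_zsmul,
          LinearMap.smul_apply, LinearMap.smul_apply, hpair, smul_comm]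
        simp
      · simp [hij]
  rw [map_add, LinearMap.add_apply, hE, hcoboundary, smul_smul, ← pow_add]
  have hodd : Odd (p + 1 + p) := ⟨p, by ring⟩
  rw [hodd.neg_one_pow]
  simp
end

section
/- Let k be a field and define a k-bilinear bracket on the polynomial algebra k[x, y, z] by {a, b} := xy(∂_x a ∂_y b − ∂_y a ∂_x b) + yz(∂_y a ∂_z b − ∂_z a ∂_y b) − xz(∂_x a ∂_z b − ∂_z a ∂_x b) (so {x,y} = xy, {y,z} = yz, {x,z} = −xz). Then this bracket satisfies the Jacobi identity {a,{b,c}} + {b,{c,a}} + {c,{a,b}} = 0 for all a, b, c ∈ k[x,y,z], and the ideal I = (x², y², z²) is a Poisson ideal: {a, b} ∈ I whenever a ∈ I and b ∈ k[x,y,z]. Hence the bracket descends to a Poisson algebra structure on S = k[x,y,z]/(x², y², z²). -/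
open MvPolynomial

/-- The bracket `{a, b} = xy(∂ₓa ∂ᵧb − ∂ᵧa ∂ₓb) + yz(∂ᵧa ∂_z b − ∂_z a ∂ᵧb)
− xz(∂ₓa ∂_z b − ∂_z a ∂ₓb)` on `k[x, y, z]`, where `x = X 0`, `y = X 1`,
`z = X 2`.  It satisfies `{x,y} = xy`, `{y,z} = yz`, `{x,z} = −xz`. -/
noncomputable def pbr {k : Type*} [CommRing k]
    (a b : MvPolynomial (Fin 3) k) : MvPolynomial (Fin 3) k :=
  X 0 * X 1 * (pderiv 0 a * pderiv 1 b - pderiv 1 a * pderiv 0 b)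
  + X 1 * X 2 * (pderiv 1 a * pderiv 2 b - pderiv 2 a * pderiv 1 b)
  - X 0 * X 2 * (pderiv 0 a * pderiv 2 b - pderiv 2 a * pderiv 0 b)

theorem MvPolynomial.pderiv_pderiv_comm {R σ : Type*} [CommRing R] (i j : σ)
    (p : MvPolynomial σ R) : pderiv i (pderiv j p) = pderiv j (pderiv i p) := by
  classical
  have h : ⁅pderiv (R := R) i, pderiv (R := R) j⁆ = 0 := by
    refine MvPolynomial.derivation_ext fun l => ?_
    rw [Derivation.commutator_apply, pderiv_X, pderiv_X]
    simp only [Pi.single_apply]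
    split_ifs <;> simp
  have h' := DFunLike.congr_fun h p
  rwa [Derivation.commutator_apply, Derivation.zero_apply, sub_eq_zero] at h'

theorem pbr_jacobi {k : Type*} [CommRing k] (a b c : MvPolynomial (Fin 3) k) :
    pbr a (pbr b c) + pbr b (pbr c a) + pbr c (pbr a b) = 0 := by
  simp only [pbr, map_add, map_sub, Derivation.leibniz, smul_eq_mul, pderiv_X_self,
    pderiv_X_of_ne (show (0 : Fin 3) ≠ 1 by decide), pderiv_X_of_ne (show (0 : Fin 3) ≠ 2 by decide),
    pderiv_X_of_ne (show (1 : Fin 3) ≠ 0 by decide), pderiv_X_of_ne (show (1 : Fin 3) ≠ 2 by decide),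
    pderiv_X_of_ne (show (2 : Fin 3) ≠ 0 by decide), pderiv_X_of_ne (show (2 : Fin 3) ≠ 1 by decide),
    pderiv_pderiv_comm (1 : Fin 3) 0, pderiv_pderiv_comm (2 : Fin 3) 0,
    pderiv_pderiv_comm (2 : Fin 3) 1]
  ring

theorem pbr_add_left {k : Type*} [CommRing k] (a b c : MvPolynomial (Fin 3) k) :
    pbr (a + b) c = pbr a c + pbr b c := by
  simp only [pbr, map_add]
  ring

theorem pbr_mul_left {k : Type*} [CommRing k] (a b c : MvPolynomial (Fin 3) k) :
    pbr (a * b) c = a * pbr b c + b * pbr a c := by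
  simp only [pbr, Derivation.leibniz, smul_eq_mul]
  ring

/-- Every variable divides its own brackets. -/
theorem X_dvd_pbr_X {k : Type*} [CommRing k] (i : Fin 3) (b : MvPolynomial (Fin 3) k) :
    X i ∣ pbr (X i) b := by
  fin_cases i
  · refine ⟨X 1 * pderiv 1 b - X 2 * pderiv 2 b, ?_⟩
    simp [pbr, pderiv_X]
    ring
  · refine ⟨X 2 * pderiv 2 b - X 0 * pderiv 0 b, ?_⟩
    simp [pbr, pderiv_X]
    ring
  · refine ⟨X 0 * pderiv 0 b - X 1 * pderiv 1 b, ?_⟩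
    simp [pbr, pderiv_X]
    ring

theorem X_sq_dvd_pbr_X_sq {k : Type*} [CommRing k] (i : Fin 3) (b : MvPolynomial (Fin 3) k) :
    X i ^ 2 ∣ pbr (X i ^ 2) b := by
  rw [sq, pbr_mul_left]
  exact dvd_add (mul_dvd_mul_left _ (X_dvd_pbr_X i b)) (mul_dvd_mul_left _ (X_dvd_pbr_X i b))

/-- To see that an ideal is a Poisson ideal, it suffices to bracket its generators. -/
theorem pbr_mem_span {k : Type*} [CommRing k] {s : Set (MvPolynomial (Fin 3) k)}
    {b : MvPolynomial (Fin 3) k} (hs : ∀ g ∈ s, pbr g b ∈ Ideal.span s)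
    {a : MvPolynomial (Fin 3) k} (ha : a ∈ Ideal.span s) : pbr a b ∈ Ideal.span s := by
  induction ha using Submodule.span_induction with
  | mem g hg => exact hs g hg
  | zero => simp [pbr]
  | add p q _ _ hp hq => exact pbr_add_left p q b ▸ add_mem hp hq
  | smul r p hp h =>
    rw [smul_eq_mul, pbr_mul_left]
    exact add_mem (Ideal.mul_mem_left _ r h) (Ideal.mul_mem_right _ _ hp)

/-- the bracket `pbr` on `k[x,y,z]` satisfies the Jacobi
identity, and the ideal `(x², y², z²)` is a Poisson ideal; hence the bracket
descends to a Poisson algebra structure on `S = k[x,y,z]/(x², y², z²)`. -/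
theorem jacobi_and_poisson_ideal (k : Type*) [Field k] :
    (∀ a b c : MvPolynomial (Fin 3) k,
      pbr a (pbr b c) + pbr b (pbr c a) + pbr c (pbr a b) = 0) ∧
    (∀ a ∈ Ideal.span {(X 0 : MvPolynomial (Fin 3) k)^2, (X 1)^2, (X 2)^2},
      ∀ b : MvPolynomial (Fin 3) k,
        pbr a b ∈ Ideal.span {(X 0 : MvPolynomial (Fin 3) k)^2, (X 1)^2, (X 2)^2}) := by
  refine ⟨pbr_jacobi, fun a ha b => pbr_mem_span ?_ ha⟩
  rintro g hg
  refine Ideal.mem_of_dvd _ ?_ (Ideal.subset_span hg)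
  obtain rfl | rfl | rfl := hg <;> exact X_sq_dvd_pbr_X_sq _ b
end
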